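/- arXiv:2605.21337 — 3 statements merged into one kernel-verified Lean document; each statement's English description precedes it below -/
import Mathlib

section
/- Every renaming r : m → n (i.e., every function from Fin m to Fin n) belongs to the least family of renamings that contains the identity id₁ : 1 → 1, the swap σ_{1,1} : 2 → 2, the copy Δ₁ : 2 → 1 and the discard !₁ : 0 → 1, and is closed under composition and block sum. -/
universe u

/-- A renaming from `m` to `n` is a function `Fin m → Fin n`. -/
abbrev Ren (m n : ℕ) : Type := Fin m → Fin n

/-- The identity renaming. -/
def idRen (n : ℕ) : Ren n n := fun i => i

/-- Block sum of renamings. -/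
def bsum {m₁ n₁ m₂ n₂ : ℕ} (r : Ren m₁ n₁) (r' : Ren m₂ n₂) : Ren (m₁ + m₂) (n₁ + n₂) :=
  fun i => Fin.addCases (motive := fun _ => Fin (n₁ + n₂))
    (fun a => Fin.castAdd n₂ (r a)) (fun b => Fin.natAdd n₁ (r' b)) i

/-- The block swap `σ_{m,n} : m+n → n+m`. -/
def swapRen (m n : ℕ) : Ren (m + n) (n + m) :=
  fun i => Fin.addCases (motive := fun _ => Fin (n + m))
    (fun a => Fin.natAdd n a) (fun b => Fin.castAdd m b) i

/-- The copy renaming `Δ_n : n+n → n`, sending both copies of `i` to `i`. -/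
def copyRen (n : ℕ) : Ren (n + n) n :=
  fun i => Fin.addCases (motive := fun _ => Fin n) (fun a => a) (fun b => b) i

/-- The discard renaming `!_n : 0 → n` (the empty function). -/
def discardRen (n : ℕ) : Ren 0 n := fun i => i.elim0

/-- Cast along an equality of arities. -/
def acast {C : ℕ → Type u} {m n : ℕ} (h : m = n) : C m → C n := fun x => h ▸ x

/-- Cast along equalities of both arities. -/
def hcast {H : ℕ → ℕ → Type u} {a a' b b' : ℕ} (h₁ : a = a') (h₂ : b = b') : H a b → H a' b' :=
  fun f => h₂ ▸ h₁ ▸ f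

/-- The least family of renamings containing the identity `id₁ : 1 → 1`, the swap
`σ_{1,1} : 2 → 2`, the copy `Δ₁ : 2 → 1` and the discard `!₁ : 0 → 1`, closed under
composition and block sum (the empty renaming `id₀` being the nullary block sum). -/
inductive RenGen : ∀ {m n : ℕ}, Ren m n → Prop
  | nil : RenGen (idRen 0)
  | id1 : RenGen (idRen 1)
  | swap : RenGen (swapRen 1 1)
  | copy : RenGen (copyRen 1)
  | discard : RenGen (discardRen 1)
  | comp : ∀ {m n k : ℕ} {r₁ : Ren m n} {r₂ : Ren n k}, RenGen r₁ → RenGen r₂ → RenGen (r₂ ∘ r₁)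
  | block : ∀ {m₁ n₁ m₂ n₂ : ℕ} {r : Ren m₁ n₁} {r' : Ren m₂ n₂},
      RenGen r → RenGen r' → RenGen (bsum r r')

@[simp]
theorem bsum_castAdd {m₁ n₁ m₂ n₂ : ℕ} (r : Ren m₁ n₁) (r' : Ren m₂ n₂) (i : Fin m₁) :
    bsum r r' (Fin.castAdd m₂ i) = Fin.castAdd n₂ (r i) := by
  simp [bsum]

@[simp]
theorem bsum_natAdd {m₁ n₁ m₂ n₂ : ℕ} (r : Ren m₁ n₁) (r' : Ren m₂ n₂) (j : Fin m₂) :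
    bsum r r' (Fin.natAdd m₁ j) = Fin.natAdd n₁ (r' j) := by
  simp [bsum]

theorem renGen_idRen : ∀ n : ℕ, RenGen (idRen n)
  | 0 => .nil
  | n + 1 => by
    have h : idRen (n + 1) = bsum (idRen n) (idRen 1) := by
      funext i
      induction i using Fin.addCases (m := n) (n := 1) <;> simp [idRen]
    exact h ▸ .block (renGen_idRen n) .id1

theorem renGen_discardRen : ∀ n : ℕ, RenGen (discardRen n)
  | 0 => by
    rw [Subsingleton.elim (discardRen 0) (idRen 0)]
    exact .nil
  | n + 1 => by
    rw [Subsingleton.elim (discardRen (n + 1)) (bsum (discardRen n) (discardRen 1))]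
    exact .block (renGen_discardRen n) .discard

/-- The renaming `n+1 → n` that is the identity on the first `n` points and sends the last
point to `k`. -/
def mergeRen {n : ℕ} (k : Fin n) : Ren (n + 1) n :=
  Fin.snoc (α := fun _ => Fin n) (idRen n) k

@[simp]
theorem mergeRen_castSucc {n : ℕ} (k i : Fin n) : mergeRen k i.castSucc = i := by
  simp [mergeRen, idRen]

@[simp]
theorem mergeRen_last {n : ℕ} (k : Fin n) : mergeRen k (Fin.last n) = k := by
  simp [mergeRen]

theorem mergeRen_last_eq (n : ℕ) :
    mergeRen (Fin.last n) = bsum (idRen n) (copyRen 1) := by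
  funext i
  induction i using Fin.lastCases with
  | last =>
    rw [mergeRen_last]
    exact (bsum_natAdd (idRen n) (copyRen 1) 1).symm
  | cast i =>
    rw [mergeRen_castSucc]
    induction i using Fin.lastCases with
    | last => exact (bsum_natAdd (idRen n) (copyRen 1) 0).symm
    | cast i => exact (bsum_castAdd (idRen n) (copyRen 1) i).symm

theorem mergeRen_castSucc_eq {n : ℕ} (k : Fin n) :
    mergeRen k.castSucc =
      bsum (mergeRen k) (idRen 1) ∘ bsum (m₂ := 2) (n₂ := 2) (idRen n) (swapRen 1 1) := by
  funext i
  induction i using Fin.lastCases with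
  | last =>
    have h₁ : bsum (idRen n) (swapRen 1 1) (Fin.last (n + 1)) = (Fin.last n).castSucc :=
      bsum_natAdd (idRen n) (swapRen 1 1) 1
    have h₂ := bsum_castAdd (mergeRen k) (idRen 1) (Fin.last n)
    rw [mergeRen_last] at h₂ ⊢
    exact (congrArg _ h₁ |>.trans h₂).symm
  | cast i =>
    rw [mergeRen_castSucc]
    induction i using Fin.lastCases with
    | last =>
      have h₁ : bsum (idRen n) (swapRen 1 1) (Fin.last n).castSucc = Fin.last (n + 1) :=
        bsum_natAdd (idRen n) (swapRen 1 1) 0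
      have h₂ := bsum_natAdd (mergeRen k) (idRen 1) 0
      exact (congrArg _ h₁ |>.trans h₂).symm
    | cast i =>
      have h₁ : bsum (idRen n) (swapRen 1 1) i.castSucc.castSucc = i.castSucc.castSucc :=
        bsum_castAdd (idRen n) (swapRen 1 1) i
      have h₂ := bsum_castAdd (mergeRen k) (idRen 1) i.castSucc
      rw [mergeRen_castSucc] at h₂
      exact (congrArg _ h₁ |>.trans h₂).symm

theorem renGen_mergeRen : ∀ {n : ℕ} (k : Fin n), RenGen (mergeRen k)
  | 0, k => k.elim0
  | n + 1, k => by
    induction k using Fin.lastCases with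
    | last =>
      rw [mergeRen_last_eq]
      exact .block (renGen_idRen n) .copy
    | cast k =>
      rw [mergeRen_castSucc_eq]
      exact .comp (.block (renGen_idRen n) .swap) (.block (renGen_mergeRen k) .id1)

theorem eq_mergeRen_comp_bsum {m n : ℕ} (r : Ren (m + 1) n) :
    r = mergeRen (r (Fin.last m)) ∘ bsum (fun i => r i.castSucc) (idRen 1) := by
  funext i
  induction i using Fin.lastCases with
  | last =>
    have h := bsum_natAdd (fun i : Fin m => r i.castSucc) (idRen 1) 0
    exact (congrArg _ h |>.trans (mergeRen_last _)).symm
  | cast i =>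
    have h := bsum_castAdd (fun i : Fin m => r i.castSucc) (idRen 1) i
    exact (congrArg _ h |>.trans (mergeRen_castSucc _ _)).symm

/-- Every renaming `r : m → n` is generated by composition and block sum from
`id₁`, `σ_{1,1}`, `Δ₁` and `!₁`. -/
theorem stmt0 {m n : ℕ} (r : Ren m n) : RenGen r := by
  induction m with
  | zero =>
    rw [Subsingleton.elim r (discardRen n)]
    exact renGen_discardRen n
  | succ m ih =>
    rw [eq_mergeRen_comp_bsum r]
    exact .comp (.block (ih _) .id1) (renGen_mergeRen _)
end

section
/- Every permutation (bijective renaming) r : n → n belongs to the least family of renamings that contains the identity id₁ : 1 → 1 and the swap σ_{1,1} : 2 → 2, and is closed under composition and block sum. -/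
universe u

/-- The least family of renamings containing the identity `id₁ : 1 → 1` and the swap
`σ_{1,1} : 2 → 2`, closed under composition and block sum (the empty renaming `id₀`
being the nullary block sum). -/
inductive PermGen : ∀ {m n : ℕ}, Ren m n → Prop
  | nil : PermGen (idRen 0)
  | id1 : PermGen (idRen 1)
  | swap : PermGen (swapRen 1 1)
  | comp : ∀ {m n k : ℕ} {r₁ : Ren m n} {r₂ : Ren n k}, PermGen r₁ → PermGen r₂ → PermGen (r₂ ∘ r₁)
  | block : ∀ {m₁ n₁ m₂ n₂ : ℕ} {r : Ren m₁ n₁} {r' : Ren m₂ n₂},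
      PermGen r → PermGen r' → PermGen (bsum r r')

lemma bsum_idRen (m n : ℕ) : bsum (idRen m) (idRen n) = idRen (m + n) := by
  funext i
  refine Fin.addCases (fun a => ?_) (fun b => ?_) i <;> simp [bsum, idRen]

lemma permGen_idRen : ∀ n : ℕ, PermGen (idRen n)
  | 0 => .nil
  | n + 1 => bsum_idRen n 1 ▸ .block (permGen_idRen n) .id1

lemma swap_eq_bsum (a k : ℕ) (i j : Fin (a + (1 + 1) + k))
    (hi : (i : ℕ) = a) (hj : (j : ℕ) = a + 1) :
    (Equiv.swap i j : Ren _ _) = bsum (bsum (idRen a) (swapRen 1 1)) (idRen k) := by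
  funext x
  refine Fin.addCases (fun y => ?_) (fun c => ?_) x
  · refine Fin.addCases (fun b => ?_) (fun b => ?_) y
    · rw [Equiv.swap_apply_of_ne_of_ne]
      · simp [bsum, idRen]
      all_goals simp only [ne_eq, Fin.ext_iff, Fin.val_castAdd]; omega
    · refine Fin.addCases (fun b => ?_) (fun b => ?_) b
      · obtain rfl : Fin.castAdd k (Fin.natAdd a (Fin.castAdd 1 b)) = i := by
          ext; simp [hi]
        rw [Equiv.swap_apply_left]
        ext; simp [bsum, swapRen, hj]
      · obtain rfl : Fin.castAdd k (Fin.natAdd a (Fin.natAdd 1 b)) = j := by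
          ext; simp [hj]
        rw [Equiv.swap_apply_right]
        ext; simp only [bsum, swapRen, Fin.addCases_left, Fin.addCases_right]; simp [hi]
  · rw [Equiv.swap_apply_of_ne_of_ne]
    · simp [bsum, idRen]
    all_goals simp only [ne_eq, Fin.ext_iff, Fin.val_natAdd]; omega

lemma PermGen.swap_adjacent {n : ℕ} {i j : Fin n} (h : (j : ℕ) = i + 1) :
    PermGen (Equiv.swap i j : Ren n n) := by
  obtain ⟨a, ha⟩ : ∃ a, (i : ℕ) = a := ⟨_, rfl⟩
  obtain ⟨k, rfl⟩ : ∃ k, n = a + (1 + 1) + k := ⟨n - (a + 2), by omega⟩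
  rw [swap_eq_bsum a k i j ha (by omega)]
  exact .block (.block (permGen_idRen a) .swap) (permGen_idRen k)

lemma PermGen.perm {n : ℕ} (e : Equiv.Perm (Fin n)) : PermGen (e : Ren n n) := by
  cases n with
  | zero => exact Subsingleton.elim (idRen 0) e ▸ .nil
  | succ n =>
    have he : e ∈ Submonoid.closure
        (Set.range fun i : Fin n => Equiv.swap i.castSucc i.succ) := by
      rw [Equiv.Perm.mclosure_swap_castSucc_succ]
      trivial
    induction he using Submonoid.closure_induction with
    | mem x hx =>
      obtain ⟨i, rfl⟩ := hx
      exact .swap_adjacent (by simp)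
    | one => exact permGen_idRen _
    | mul x y _ _ hx hy => exact PermGen.comp (r₁ := y) (r₂ := x) hy hx

/-- Every permutation (bijective renaming) `r : n → n` is generated by composition and
block sum from `id₁` and `σ_{1,1}`. -/
theorem stmt1 {n : ℕ} (r : Ren n n) (hr : Function.Bijective r) : PermGen r :=
  PermGen.perm (Equiv.ofBijective r hr)
end

section
/- For every symmetric Ren-cartesian preoperad C, the substitution construction SUB[C] — with objects ℕ, morphisms m → n the equivalence classes of pre-substitutions, composition given by concatenation, identity the empty word, whiskering k ⋊ (−) and (−) ⋉ k defined stepwise by padding the arity data of each single substitution and renaming step, and symmetries given by the singleton renaming words [σ_{m,n}] — is a pre-PROP. -/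
universe u

/-- A preoperad: a family of sets `C n` with an identity `one ∈ C 1` and single
substitution `f{n₁ ⊣ g ⊢ n₂}`, satisfying unit and associativity laws. -/
structure Preoperad where
  C : ℕ → Type
  one : C 1
  subst : ∀ (n₁ n₂ : ℕ) {m : ℕ}, C (n₁ + 1 + n₂) → C m → C (n₁ + m + n₂)
  left_unit : ∀ {m : ℕ} (g : C m), subst 0 0 one g = acast (C := C) (by omega) g
  right_unit : ∀ {n₁ n₂ : ℕ} (f : C (n₁ + 1 + n₂)), subst n₁ n₂ f one = f
  assoc : ∀ {m₁ m₂ n₁ n₂ k : ℕ} (f : C (m₁ + 1 + m₂)) (g : C (n₁ + 1 + n₂)) (h : C k),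
    subst (m₁ + n₁) (n₂ + m₂) (acast (C := C) (by omega) (subst m₁ m₂ f g)) h =
      acast (C := C) (by omega) (subst m₁ m₂ f (subst n₁ n₂ g h))

/-- Two elements `g₁ ∈ C k₁`, `g₂ ∈ C k₂` of a preoperad commute when substituting them
into the two distinguished inputs of any morphism in either order yields the same
result (in both orientations). -/
def Preoperad.Commute (P : Preoperad) {k₁ k₂ : ℕ} (g₁ : P.C k₁) (g₂ : P.C k₂) : Prop :=
  ∀ (m₁ m m₂ : ℕ) (f : P.C (m₁ + 1 + m + 1 + m₂)),
    (P.subst (m₁ + k₁ + m) m₂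
        (acast (C := P.C) (by omega)
          (P.subst m₁ (m + 1 + m₂) (acast (C := P.C) (by omega) f) g₁)) g₂ =
      acast (C := P.C) (by omega)
        (P.subst m₁ (m + k₂ + m₂)
          (acast (C := P.C) (by omega) (P.subst (m₁ + 1 + m) m₂ f g₂)) g₁)) ∧
    (P.subst (m₁ + k₂ + m) m₂
        (acast (C := P.C) (by omega)
          (P.subst m₁ (m + 1 + m₂) (acast (C := P.C) (by omega) f) g₂)) g₁ =
      acast (C := P.C) (by omega)
        (P.subst m₁ (m + k₁ + m₂)
          (acast (C := P.C) (by omega) (P.subst (m₁ + 1 + m) m₂ f g₁)) g₂))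

/-- An element is central if it commutes with every element. -/
def Preoperad.Central (P : Preoperad) {k : ℕ} (g : P.C k) : Prop :=
  ∀ {k' : ℕ} (g' : P.C k'), P.Commute g g'

/-- A `Ren`-cartesian preoperad: a preoperad equipped with reindexing `f[r]` along all
renamings, functorially, and satisfying the renaming–substitution interchange law. -/
structure RenPreoperad extends Preoperad where
  ren : ∀ {m n : ℕ}, C m → Ren m n → C n
  ren_id : ∀ {m : ℕ} (f : C m), ren f (idRen m) = f
  ren_comp : ∀ {m n k : ℕ} (f : C m) (r₁ : Ren m n) (r₂ : Ren n k),
    ren f (r₂ ∘ r₁) = ren (ren f r₁) r₂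
  ren_subst : ∀ {n₁ n₂ k m₁ m₂ m : ℕ} (f : C (n₁ + 1 + n₂)) (g : C k)
      (r₁ : Ren n₁ m₁) (r : Ren k m) (r₂ : Ren n₂ m₂),
    ren (subst n₁ n₂ f g) (bsum (bsum r₁ r) r₂) =
      subst m₁ m₂ (ren f (bsum (bsum r₁ (idRen 1)) r₂)) (ren g r)

/-- A symmetric `Ren`-cartesian preoperad: transpositions are natural with respect to
single substitution, in both orientations. -/
structure SymRenPreoperad extends RenPreoperad where
  sym_nat₁ : ∀ {m₁ m₂ n : ℕ} (f : C (m₁ + 2 + m₂)) (g : C n),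
    subst m₁ (1 + m₂)
        (acast (C := C) (by omega)
          (ren f (bsum (bsum (idRen m₁) (swapRen 1 1)) (idRen m₂)))) g =
      acast (C := C) (by omega)
        (ren (acast (C := C) (by omega) (subst (m₁ + 1) m₂ f g))
          (bsum (bsum (idRen m₁) (swapRen 1 n)) (idRen m₂)))
  sym_nat₂ : ∀ {m₁ m₂ n : ℕ} (f : C (m₁ + 2 + m₂)) (g : C n),
    subst (m₁ + 1) m₂
        (ren f ((bsum (bsum (idRen m₁) (swapRen 1 1)) (idRen m₂) :
          Ren (m₁ + (1 + 1) + m₂) (m₁ + (1 + 1) + m₂)))) g =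
      acast (C := C) (by omega)
        (ren (acast (C := C) (by omega) (subst m₁ (1 + m₂) (acast (C := C) (by omega) f) g))
          (bsum (bsum (idRen m₁) (swapRen n 1)) (idRen m₂)))

/-- A cartesian operad: a `Ren`-cartesian symmetric preoperad in which every element is
central and in which discard and copy are natural with respect to single substitution. -/
structure CartOperad extends SymRenPreoperad where
  central : ∀ {k : ℕ} (g : C k), toPreoperad.Central g
  discard_nat : ∀ {m₁ m₂ n : ℕ} (f : C (m₁ + 0 + m₂)) (g : C n),
    subst m₁ m₂
        (ren f ((bsum (bsum (idRen m₁) (discardRen 1)) (idRen m₂) :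
          Ren (m₁ + 0 + m₂) (m₁ + 1 + m₂)))) g =
      ren f ((bsum (bsum (idRen m₁) (discardRen n)) (idRen m₂) :
        Ren (m₁ + 0 + m₂) (m₁ + n + m₂)))
  copy_nat : ∀ {m₁ m₂ n : ℕ} (f : C (m₁ + 2 + m₂)) (g : C n),
    subst m₁ m₂
        (ren f ((bsum (bsum (idRen m₁) (copyRen 1)) (idRen m₂) :
          Ren (m₁ + (1 + 1) + m₂) (m₁ + 1 + m₂)))) g =
      ren (acast (C := C) (by omega)
            (subst m₁ (n + m₂) (acast (C := C) (by omega) (subst (m₁ + 1) m₂ f g)) g))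
        ((bsum (bsum (idRen m₁) (copyRen n)) (idRen m₂) :
          Ren (m₁ + (n + n) + m₂) (m₁ + n + m₂)))

/-- A cartesian preoperad functor: preserves the identity, single substitution and
reindexing. -/
structure RenPreoperadHom (P Q : RenPreoperad) where
  map : ∀ {n : ℕ}, P.C n → Q.C n
  map_one : map P.one = Q.one
  map_subst : ∀ {n₁ n₂ m : ℕ} (f : P.C (n₁ + 1 + n₂)) (g : P.C m),
    map (P.subst n₁ n₂ f g) = Q.subst n₁ n₂ (map f) (map g)
  map_ren : ∀ {m n : ℕ} (f : P.C m) (r : Ren m n), map (P.ren f r) = Q.ren (map f) r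

/-- Composition of cartesian preoperad functors. -/
def RenPreoperadHom.comp {P Q R : RenPreoperad} (F : RenPreoperadHom P Q)
    (G : RenPreoperadHom Q R) : RenPreoperadHom P R where
  map f := G.map (F.map f)
  map_one := by show G.map (F.map P.one) = _; rw [F.map_one, G.map_one]
  map_subst f g := by
    show G.map (F.map _) = _
    rw [F.map_subst, G.map_subst]
  map_ren f r := by
    show G.map (F.map _) = _
    rw [F.map_ren, G.map_ren]

/-- A Freyd operad: a cartesian operad `V` of values, a symmetric `Ren`-cartesian
preoperad `C` of computations, and a cartesian preoperad functor `I : V → C` whose image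
consists of central elements (and hence forms a cartesian operad). -/
structure FreydOperad where
  V : CartOperad
  C : SymRenPreoperad
  I : RenPreoperadHom V.toRenPreoperad C.toRenPreoperad
  I_central : ∀ {n : ℕ} (v : V.C n), C.toPreoperad.Central (I.map v)

/-- A Freyd operad functor: a pair of cartesian preoperad functors commuting with the
functors `I`. -/
structure FreydOperadHom (O₁ O₂ : FreydOperad) where
  mapV : RenPreoperadHom O₁.V.toRenPreoperad O₂.V.toRenPreoperad
  mapC : RenPreoperadHom O₁.C.toRenPreoperad O₂.C.toRenPreoperad
  square : ∀ {n : ℕ} (v : O₁.V.C n), mapC.map (O₁.I.map v) = O₂.I.map (mapV.map v)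

/-- Composition of Freyd operad functors. -/
def FreydOperadHom.comp {O₁ O₂ O₃ : FreydOperad} (F : FreydOperadHom O₁ O₂)
    (G : FreydOperadHom O₂ O₃) : FreydOperadHom O₁ O₃ where
  mapV := F.mapV.comp G.mapV
  mapC := F.mapC.comp G.mapC
  square v := by
    show G.mapC.map (F.mapC.map _) = _
    rw [F.square, G.square]; rfl

/-- A weakly closed Freyd operad: abstraction `λₙ : C(n+1) → V(n)` and application
`@ ∈ C 2` satisfying the β-law and compatibility of abstraction with substitution. -/
structure WCFreydOperad extends FreydOperad where
  abs : ∀ {n : ℕ}, C.C (n + 1) → V.C n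
  app : C.C 2
  beta : ∀ {n : ℕ} (f : C.C (n + 1)),
    C.subst 0 1 app (I.map (abs f)) = acast (C := C.C) (by omega) f
  abs_subst : ∀ {m₁ m₂ k : ℕ} (f : C.C (m₁ + 1 + (m₂ + 1))) (v : V.C k),
    abs (acast (C := C.C) (by omega) (C.subst m₁ (m₂ + 1) f (I.map v))) =
      V.subst m₁ m₂ (abs (acast (C := C.C) (by omega) f)) v

/-- Pre-substitutions over a family of carriers `C`: finite words of single
substitutions `⟨m₁ ⊣ g ⊢ m₂⟩` and renamings (read contravariantly), with matching
arities.  A term `s : PreSub C m n` is a word from `m` to `n`; the head of the word is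
the step applied first to an element of `C n`. -/
inductive PreSub (C : ℕ → Type) : ℕ → ℕ → Type
  | nil {n : ℕ} : PreSub C n n
  | subCons {m : ℕ} (m₁ m₂ : ℕ) {k : ℕ} (g : C k) (rest : PreSub C m (m₁ + k + m₂)) :
      PreSub C m (m₁ + 1 + m₂)
  | renCons {m a b : ℕ} (r : Ren a b) (rest : PreSub C m b) : PreSub C m a

namespace PreSub

variable {C : ℕ → Type}

/-- Cast a pre-substitution along an equality of its upper arity. -/
def castU {m n n' : ℕ} (h : n = n') (s : PreSub C m n) : PreSub C m n' := h ▸ s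

/-- Concatenation (composition) of pre-substitutions. -/
def append : ∀ {m k n : ℕ}, PreSub C k n → PreSub C m k → PreSub C m n
  | _, _, _, .nil, t => t
  | _, _, _, .subCons m₁ m₂ g rest, t => .subCons m₁ m₂ g (rest.append t)
  | _, _, _, .renCons r rest, t => .renCons r (rest.append t)

/-- Left whiskering of a pre-substitution, padding each step by `l` unused variables on
the left. -/
def whiskL (l : ℕ) : ∀ {m n : ℕ}, PreSub C m n → PreSub C (l + m) (l + n)
  | _, _, .nil => .nil
  | _, _, .subCons m₁ m₂ g rest =>
      castU (by omega) (.subCons (l + m₁) m₂ g (castU (by omega) (whiskL l rest)))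
  | _, _, .renCons r rest => .renCons (bsum (idRen l) r) (whiskL l rest)

/-- Right whiskering of a pre-substitution, padding each step by `l` unused variables on
the right. -/
def whiskR (l : ℕ) : ∀ {m n : ℕ}, PreSub C m n → PreSub C (m + l) (n + l)
  | _, _, .nil => .nil
  | _, _, .subCons m₁ m₂ g rest =>
      castU (by omega) (.subCons m₁ (m₂ + l) g (castU (by omega) (whiskR l rest)))
  | _, _, .renCons r rest => .renCons (bsum r (idRen l)) (whiskR l rest)

/-- Apply `F` to every substitution step of a word, leaving renaming steps unchanged. -/
def mapWord {C₁ C₂ : ℕ → Type} (F : ∀ {k : ℕ}, C₁ k → C₂ k) :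
    ∀ {m n : ℕ}, PreSub C₁ m n → PreSub C₂ m n
  | _, _, .nil => .nil
  | _, _, .subCons m₁ m₂ g rest => .subCons m₁ m₂ (F g) (mapWord F rest)
  | _, _, .renCons r rest => .renCons r (mapWord F rest)

/-- The singleton word `[⟨0 ⊣ g ⊢ 0⟩] : n → 1` associated to `g ∈ C n`. -/
def sing {n : ℕ} (g : C n) : PreSub C n 1 :=
  .subCons 0 0 g (castU (by omega) .nil)

end PreSub

/-- Application `f ⋆ s` of a pre-substitution `s : m → n` to `f ∈ C n`, yielding an
element of `C m`: substitution steps act by single substitution and renaming steps by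
reindexing, in the order of the word. -/
def PreSub.apply (P : RenPreoperad) : ∀ {m n : ℕ}, PreSub P.C m n → P.C n → P.C m
  | _, _, .nil, f => f
  | _, _, .subCons m₁ m₂ g rest, f => PreSub.apply P rest (P.subst m₁ m₂ f g)
  | _, _, .renCons r rest, f => PreSub.apply P rest (P.ren f r)

/-- The congruence on pre-substitutions generated by the symmetric rules of the
substitution construction (rules apply in arbitrary word contexts). -/
inductive SubEquiv (P : SymRenPreoperad) : {m n : ℕ} → PreSub P.C m n → PreSub P.C m n → Prop
  | refl {m n : ℕ} (s : PreSub P.C m n) : SubEquiv P s s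
  | symm {m n : ℕ} {s t : PreSub P.C m n} : SubEquiv P s t → SubEquiv P t s
  | trans {m n : ℕ} {s t u : PreSub P.C m n} :
      SubEquiv P s t → SubEquiv P t u → SubEquiv P s u
  | congrSub {m m₁ m₂ k : ℕ} (g : P.C k) {s t : PreSub P.C m (m₁ + k + m₂)} :
      SubEquiv P s t → SubEquiv P (.subCons m₁ m₂ g s) (.subCons m₁ m₂ g t)
  | congrRen {m a b : ℕ} (r : Ren a b) {s t : PreSub P.C m b} :
      SubEquiv P s t → SubEquiv P (.renCons r s) (.renCons r t)
  /-- (U₁) identity substitution steps are deleted -/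
  | unit₁ {m m₁ m₂ : ℕ} (s : PreSub P.C m (m₁ + 1 + m₂)) :
      SubEquiv P (.subCons m₁ m₂ P.one s) s
  /-- (U₂) identity renaming steps are deleted -/
  | unit₂ {m n : ℕ} (s : PreSub P.C m n) : SubEquiv P (.renCons (idRen n) s) s
  /-- (A) adjacent compatible substitution steps merge by operadic composition -/
  | merge {m m₁ m₂ n₁ n₂ k : ℕ} (g : P.C (n₁ + 1 + n₂)) (h : P.C k)
      (rest : PreSub P.C m (m₁ + n₁ + k + (n₂ + m₂))) :
      SubEquiv P
        (.subCons m₁ m₂ g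
          (PreSub.castU (by omega) (.subCons (m₁ + n₁) (n₂ + m₂) h rest)))
        (.subCons m₁ m₂ (P.subst n₁ n₂ g h) (PreSub.castU (by omega) rest))
  /-- (R) adjacent renaming steps compose -/
  | renComp {m a b c : ℕ} (r₁ : Ren a b) (r₂ : Ren b c) (rest : PreSub P.C m c) :
      SubEquiv P (.renCons r₁ (.renCons r₂ rest)) (.renCons (r₂ ∘ r₁) rest)
  /-- (N) a substitution step followed by a compatible renaming equals the reindexed
  substitution preceded by a renaming -/
  | interchange {m n₁ n₂ k a b c : ℕ} (v : P.C k)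
      (ρ₁ : Ren n₁ a) (ρ : Ren k b) (ρ₂ : Ren n₂ c)
      (rest : PreSub P.C m (a + b + c)) :
      SubEquiv P
        (.subCons n₁ n₂ v (.renCons (bsum (bsum ρ₁ ρ) ρ₂) rest))
        (.renCons (bsum (bsum ρ₁ (idRen 1)) ρ₂) (.subCons a c (P.ren v ρ) rest))
  /-- (S_ℓ) transposition renamings commute with substitution steps -/
  | symL {m m₁ m₂ n : ℕ} (g : P.C n) (rest : PreSub P.C m (m₁ + n + (1 + m₂))) :
      SubEquiv P
        (.renCons (bsum (bsum (idRen m₁) (swapRen 1 1)) (idRen m₂))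
          (PreSub.castU (by omega) (.subCons m₁ (1 + m₂) g rest)))
        (.subCons (m₁ + 1) m₂ g
          (PreSub.castU (by omega)
            (.renCons (bsum (bsum (idRen m₁) (swapRen 1 n)) (idRen m₂))
              (PreSub.castU (by omega) rest))))
  /-- (S_r) transposition renamings commute with substitution steps -/
  | symR {m m₁ m₂ n : ℕ} (g : P.C n) (rest : PreSub P.C m (m₁ + 1 + n + m₂)) :
      SubEquiv P
        (.renCons (bsum (bsum (idRen m₁) (swapRen 1 1)) (idRen m₂))
          (.subCons (m₁ + 1) m₂ g (PreSub.castU (by omega) rest)))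
        (PreSub.castU (by omega)
          (.subCons m₁ (1 + m₂) g
            (PreSub.castU (by omega)
              (.renCons (bsum (bsum (idRen m₁) (swapRen n 1)) (idRen m₂))
                (PreSub.castU (by omega) rest)))))

/-- The congruence on pre-substitutions generated by the symmetric rules together with
the cartesian rules (centrality of substitution steps, naturality of discard and copy). -/
inductive CSubEquiv (V : CartOperad) : {m n : ℕ} → PreSub V.C m n → PreSub V.C m n → Prop
  | refl {m n : ℕ} (s : PreSub V.C m n) : CSubEquiv V s s
  | symm {m n : ℕ} {s t : PreSub V.C m n} : CSubEquiv V s t → CSubEquiv V t s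
  | trans {m n : ℕ} {s t u : PreSub V.C m n} :
      CSubEquiv V s t → CSubEquiv V t u → CSubEquiv V s u
  | congrSub {m m₁ m₂ k : ℕ} (g : V.C k) {s t : PreSub V.C m (m₁ + k + m₂)} :
      CSubEquiv V s t → CSubEquiv V (.subCons m₁ m₂ g s) (.subCons m₁ m₂ g t)
  | congrRen {m a b : ℕ} (r : Ren a b) {s t : PreSub V.C m b} :
      CSubEquiv V s t → CSubEquiv V (.renCons r s) (.renCons r t)
  | unit₁ {m m₁ m₂ : ℕ} (s : PreSub V.C m (m₁ + 1 + m₂)) :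
      CSubEquiv V (.subCons m₁ m₂ V.one s) s
  | unit₂ {m n : ℕ} (s : PreSub V.C m n) : CSubEquiv V (.renCons (idRen n) s) s
  | merge {m m₁ m₂ n₁ n₂ k : ℕ} (g : V.C (n₁ + 1 + n₂)) (h : V.C k)
      (rest : PreSub V.C m (m₁ + n₁ + k + (n₂ + m₂))) :
      CSubEquiv V
        (.subCons m₁ m₂ g
          (PreSub.castU (by omega) (.subCons (m₁ + n₁) (n₂ + m₂) h rest)))
        (.subCons m₁ m₂ (V.subst n₁ n₂ g h) (PreSub.castU (by omega) rest))
  | renComp {m a b c : ℕ} (r₁ : Ren a b) (r₂ : Ren b c) (rest : PreSub V.C m c) :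
      CSubEquiv V (.renCons r₁ (.renCons r₂ rest)) (.renCons (r₂ ∘ r₁) rest)
  | interchange {m n₁ n₂ k a b c : ℕ} (v : V.C k)
      (ρ₁ : Ren n₁ a) (ρ : Ren k b) (ρ₂ : Ren n₂ c)
      (rest : PreSub V.C m (a + b + c)) :
      CSubEquiv V
        (.subCons n₁ n₂ v (.renCons (bsum (bsum ρ₁ ρ) ρ₂) rest))
        (.renCons (bsum (bsum ρ₁ (idRen 1)) ρ₂) (.subCons a c (V.ren v ρ) rest))
  | symL {m m₁ m₂ n : ℕ} (g : V.C n) (rest : PreSub V.C m (m₁ + n + (1 + m₂))) :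
      CSubEquiv V
        (.renCons (bsum (bsum (idRen m₁) (swapRen 1 1)) (idRen m₂))
          (PreSub.castU (by omega) (.subCons m₁ (1 + m₂) g rest)))
        (.subCons (m₁ + 1) m₂ g
          (PreSub.castU (by omega)
            (.renCons (bsum (bsum (idRen m₁) (swapRen 1 n)) (idRen m₂))
              (PreSub.castU (by omega) rest))))
  | symR {m m₁ m₂ n : ℕ} (g : V.C n) (rest : PreSub V.C m (m₁ + 1 + n + m₂)) :
      CSubEquiv V
        (.renCons (bsum (bsum (idRen m₁) (swapRen 1 1)) (idRen m₂))
          (.subCons (m₁ + 1) m₂ g (PreSub.castU (by omega) rest)))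
        (PreSub.castU (by omega)
          (.subCons m₁ (1 + m₂) g
            (PreSub.castU (by omega)
              (.renCons (bsum (bsum (idRen m₁) (swapRen n 1)) (idRen m₂))
                (PreSub.castU (by omega) rest)))))
  /-- (CEN) adjacent independent substitution steps commute -/
  | cen {m' m₁ m m₂ n₁ n₂ : ℕ} (g₁ : V.C n₁) (g₂ : V.C n₂)
      (rest : PreSub V.C m' (m₁ + n₁ + m + n₂ + m₂)) :
      CSubEquiv V
        (.subCons m₁ (m + 1 + m₂) g₁
          (PreSub.castU (by omega) (.subCons (m₁ + n₁ + m) m₂ g₂ rest)))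
        (PreSub.castU (by omega)
          (.subCons (m₁ + 1 + m) m₂ g₂
            (PreSub.castU (by omega)
              (.subCons m₁ (m + n₂ + m₂) g₁ (PreSub.castU (by omega) rest)))))
  /-- (D) a discard renaming followed by a substitution step equals a discard renaming -/
  | dis {m m₁ m₂ n : ℕ} (g : V.C n) (rest : PreSub V.C m (m₁ + n + m₂)) :
      CSubEquiv V
        (.renCons (bsum (bsum (idRen m₁) (discardRen 1)) (idRen m₂) :
            Ren (m₁ + 0 + m₂) (m₁ + 1 + m₂))
          (.subCons m₁ m₂ g rest))
        (.renCons (bsum (bsum (idRen m₁) (discardRen n)) (idRen m₂) :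
            Ren (m₁ + 0 + m₂) (m₁ + n + m₂))
          rest)
  /-- (C) a copy renaming followed by a substitution step equals a doubled substitution
  step followed by a copy renaming -/
  | cop {m m₁ m₂ n : ℕ} (g : V.C n) (rest : PreSub V.C m (m₁ + n + m₂)) :
      CSubEquiv V
        (.renCons (bsum (bsum (idRen m₁) (copyRen 1)) (idRen m₂) :
            Ren (m₁ + (1 + 1) + m₂) (m₁ + 1 + m₂))
          (.subCons m₁ m₂ g rest))
        (.subCons (m₁ + 1) m₂ g
          (PreSub.castU (by omega)
            (.subCons m₁ (n + m₂) g
              (PreSub.castU (by omega)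
                (.renCons (bsum (bsum (idRen m₁) (copyRen n)) (idRen m₂) :
                    Ren (m₁ + (n + n) + m₂) (m₁ + n + m₂))
                  rest)))))

/-- Morphisms of the substitution category `SUB[C]`: pre-substitutions modulo the
symmetric rules. -/
abbrev SUBQ (P : SymRenPreoperad) (m n : ℕ) : Type := Quot (@SubEquiv P m n)

/-- Morphisms of the cartesian substitution category `CSUB[V]`: pre-substitutions modulo
the symmetric rules together with the cartesian rules. -/
abbrev CSUBQ (V : CartOperad) (m n : ℕ) : Type := Quot (@CSubEquiv V m n)

/-- A pre-PROP structure on a hom-family `H`: a strict symmetric premonoidal category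
with objects `ℕ` and tensor given by addition, presented by composition, identities,
whiskering functors `k ⋊ (−)`, `(−) ⋉ k` and coherent natural symmetries. -/
structure PrePROPOn (H : ℕ → ℕ → Type) where
  id : ∀ n : ℕ, H n n
  comp : ∀ {a b c : ℕ}, H a b → H b c → H a c
  comp_id : ∀ {a b : ℕ} (f : H a b), comp f (id b) = f
  id_comp : ∀ {a b : ℕ} (f : H a b), comp (id a) f = f
  comp_assoc : ∀ {a b c d : ℕ} (f : H a b) (g : H b c) (h : H c d),
    comp (comp f g) h = comp f (comp g h)
  whiskL : ∀ (k : ℕ) {m n : ℕ}, H m n → H (k + m) (k + n)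
  whiskR : ∀ (k : ℕ) {m n : ℕ}, H m n → H (m + k) (n + k)
  whiskL_id : ∀ (k n : ℕ), whiskL k (id n) = id (k + n)
  whiskR_id : ∀ (k n : ℕ), whiskR k (id n) = id (n + k)
  whiskL_comp : ∀ (k : ℕ) {a b c : ℕ} (f : H a b) (g : H b c),
    whiskL k (comp f g) = comp (whiskL k f) (whiskL k g)
  whiskR_comp : ∀ (k : ℕ) {a b c : ℕ} (f : H a b) (g : H b c),
    whiskR k (comp f g) = comp (whiskR k f) (whiskR k g)
  whiskL_zero : ∀ {m n : ℕ} (f : H m n),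
    whiskL 0 f = hcast (H := H) (by omega) (by omega) f
  whiskR_zero : ∀ {m n : ℕ} (f : H m n), whiskR 0 f = f
  whiskL_add : ∀ (k l : ℕ) {m n : ℕ} (f : H m n),
    whiskL k (whiskL l f) = hcast (H := H) (by omega) (by omega) (whiskL (k + l) f)
  whiskR_add : ∀ (k l : ℕ) {m n : ℕ} (f : H m n),
    whiskR l (whiskR k f) = hcast (H := H) (by omega) (by omega) (whiskR (k + l) f)
  whisk_exch : ∀ (k l : ℕ) {m n : ℕ} (f : H m n),
    whiskL k (whiskR l f) = hcast (H := H) (by omega) (by omega) (whiskR l (whiskL k f))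
  sym : ∀ m n : ℕ, H (m + n) (n + m)
  sym_sym : ∀ m n : ℕ, comp (sym m n) (sym n m) = id (m + n)
  sym_natL : ∀ {m n : ℕ} (k : ℕ) (f : H m n),
    comp (whiskR k f) (sym n k) = comp (sym m k) (whiskL k f)
  sym_natR : ∀ {m n : ℕ} (k : ℕ) (f : H m n),
    comp (whiskL k f) (sym k n) = comp (sym k m) (whiskR k f)
  sym_add : ∀ m n k : ℕ,
    sym (m + n) k =
      hcast (H := H) rfl (by omega)
        (comp
          ((hcast (H := H) (by omega) (by omega) (whiskL m (sym n k)) :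
            H (m + n + k) (m + k + n)))
          (whiskR n (sym m k)))

/-- Tensor product of morphisms in a pre-PROP (defined via whiskering). -/
def PrePROPOn.tens {H : ℕ → ℕ → Type} (S : PrePROPOn H) {a b c d : ℕ}
    (f : H a b) (g : H c d) : H (a + c) (b + d) :=
  S.comp (S.whiskR c f) (S.whiskL b g)

/-- Centrality of a morphism of a pre-PROP: its whiskered composites with any morphism
in either order agree. -/
def PrePROPOn.Central {H : ℕ → ℕ → Type} (S : PrePROPOn H) {m n : ℕ} (f : H m n) : Prop :=
  ∀ {m' n' : ℕ} (g : H m' n'),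
    S.comp (S.whiskR m' f) (S.whiskL n g) = S.comp (S.whiskL m g) (S.whiskR n' f) ∧
    S.comp (S.whiskL m' f) (S.whiskR n g) = S.comp (S.whiskR m g) (S.whiskL n' f)

/-- A cartesian PROP structure: a pre-PROP in which every morphism is central, equipped
with natural commutative-comonoid structures (copy and discard) satisfying the comonoid
coherence laws. -/
structure CartPROPOn (H : ℕ → ℕ → Type) extends PrePROPOn H where
  allCentral : ∀ {m n : ℕ} (f : H m n), toPrePROPOn.Central f
  copy : ∀ n : ℕ, H n (n + n)
  discard : ∀ n : ℕ, H n 0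
  copy_counitL : ∀ n : ℕ,
    comp (copy n) (whiskR n (discard n)) = hcast (H := H) rfl (by omega) (id n)
  copy_counitR : ∀ n : ℕ, comp (copy n) (whiskL n (discard n)) = id n
  copy_coassoc : ∀ n : ℕ,
    comp (copy n) (whiskR n (copy n)) =
      hcast (H := H) rfl (by omega) (comp (copy n) (whiskL n (copy n)))
  copy_comm : ∀ n : ℕ, comp (copy n) (sym n n) = copy n
  copy_natural : ∀ {m n : ℕ} (f : H m n),
    comp f (copy n) = comp (copy m) (toPrePROPOn.tens f f)
  discard_natural : ∀ {m n : ℕ} (f : H m n), comp f (discard n) = discard m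
  copy_add : ∀ m n : ℕ,
    copy (m + n) =
      comp (toPrePROPOn.tens (copy m) (copy n))
        ((hcast (H := H) (by omega) (by omega) (whiskL m (whiskR n (sym m n))) :
          H (m + m + (n + n)) (m + n + (m + n))))
  discard_add : ∀ m n : ℕ, discard (m + n) = toPrePROPOn.tens (discard m) (discard n)

/-- A strict symmetric premonoidal identity-on-objects functor between pre-PROP
structures. -/
structure PrePROPHomOn {H₁ H₂ : ℕ → ℕ → Type} (S₁ : PrePROPOn H₁) (S₂ : PrePROPOn H₂) where
  map : ∀ {m n : ℕ}, H₁ m n → H₂ m n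
  map_id : ∀ n : ℕ, map (S₁.id n) = S₂.id n
  map_comp : ∀ {a b c : ℕ} (f : H₁ a b) (g : H₁ b c), map (S₁.comp f g) = S₂.comp (map f) (map g)
  map_whiskL : ∀ (k : ℕ) {m n : ℕ} (f : H₁ m n), map (S₁.whiskL k f) = S₂.whiskL k (map f)
  map_whiskR : ∀ (k : ℕ) {m n : ℕ} (f : H₁ m n), map (S₁.whiskR k f) = S₂.whiskR k (map f)
  map_sym : ∀ m n : ℕ, map (S₁.sym m n) = S₂.sym m n

/-- Composition of pre-PROP functors. -/
def PrePROPHomOn.comp {H₁ H₂ H₃ : ℕ → ℕ → Type} {S₁ : PrePROPOn H₁} {S₂ : PrePROPOn H₂}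
    {S₃ : PrePROPOn H₃} (F : PrePROPHomOn S₁ S₂) (G : PrePROPHomOn S₂ S₃) :
    PrePROPHomOn S₁ S₃ where
  map f := G.map (F.map f)
  map_id n := by show G.map (F.map _) = _; rw [F.map_id, G.map_id]
  map_comp f g := by show G.map (F.map _) = _; rw [F.map_comp, G.map_comp]
  map_whiskL := by
    intro k m n f
    show G.map (F.map _) = _; rw [F.map_whiskL, G.map_whiskL]
  map_whiskR := by
    intro k m n f
    show G.map (F.map _) = _; rw [F.map_whiskR, G.map_whiskR]
  map_sym m n := by show G.map (F.map _) = _; rw [F.map_sym, G.map_sym]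

/-- A Freyd PROP structure on a pair of hom-families: a cartesian PROP of values, a
pre-PROP of computations, and an identity-on-objects strict symmetric premonoidal
functor `J` with central image. -/
structure FreydPROPOn (HV HC : ℕ → ℕ → Type) where
  Vp : CartPROPOn HV
  Cp : PrePROPOn HC
  J : PrePROPHomOn Vp.toPrePROPOn Cp
  J_central : ∀ {m n : ℕ} (f : HV m n), Cp.Central (J.map f)

/-- A (bundled) Freyd PROP. -/
structure FreydPROP where
  HV : ℕ → ℕ → Type
  HC : ℕ → ℕ → Type
  str : FreydPROPOn HV HC

/-- A Freyd PROP functor: a pair of identity-on-objects strict symmetric premonoidal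
functors, the value part preserving copy and discard, commuting with the functors `J`. -/
structure FreydPROPHomOn {HV₁ HC₁ HV₂ HC₂ : ℕ → ℕ → Type}
    (A : FreydPROPOn HV₁ HC₁) (B : FreydPROPOn HV₂ HC₂) where
  mapV : PrePROPHomOn A.Vp.toPrePROPOn B.Vp.toPrePROPOn
  mapC : PrePROPHomOn A.Cp B.Cp
  mapV_copy : ∀ n : ℕ, mapV.map (A.Vp.copy n) = B.Vp.copy n
  mapV_discard : ∀ n : ℕ, mapV.map (A.Vp.discard n) = B.Vp.discard n
  squareJ : ∀ {m n : ℕ} (f : HV₁ m n), mapC.map (A.J.map f) = B.J.map (mapV.map f)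

/-- Composition of Freyd PROP functors. -/
def FreydPROPHomOn.comp {HV₁ HC₁ HV₂ HC₂ HV₃ HC₃ : ℕ → ℕ → Type}
    {A : FreydPROPOn HV₁ HC₁} {B : FreydPROPOn HV₂ HC₂} {Cs : FreydPROPOn HV₃ HC₃}
    (F : FreydPROPHomOn A B) (G : FreydPROPHomOn B Cs) : FreydPROPHomOn A Cs where
  mapV := F.mapV.comp G.mapV
  mapC := F.mapC.comp G.mapC
  mapV_copy n := by show G.mapV.map (F.mapV.map _) = _; rw [F.mapV_copy, G.mapV_copy]
  mapV_discard n := by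
    show G.mapV.map (F.mapV.map _) = _; rw [F.mapV_discard, G.mapV_discard]
  squareJ f := by
    show G.mapC.map (F.mapC.map _) = _
    rw [F.squareJ, G.squareJ]; rfl

/-- A cartesian PROP structure on `CSUB[V]` is induced by the substitution construction
when its identities, composition, whiskerings, symmetries, copy and discard are given on
representatives by the empty word, concatenation, stepwise padding and singleton
renaming words. -/
def InducedV (V : CartOperad) (S : CartPROPOn (CSUBQ V)) : Prop :=
  (∀ n : ℕ, S.id n = Quot.mk _ PreSub.nil) ∧
  (∀ {m k n : ℕ} (t : PreSub V.C m k) (s : PreSub V.C k n),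
    S.comp (Quot.mk _ t) (Quot.mk _ s) = Quot.mk _ (s.append t)) ∧
  (∀ (l : ℕ) {m n : ℕ} (s : PreSub V.C m n),
    S.whiskL l (Quot.mk _ s) = Quot.mk _ (s.whiskL l)) ∧
  (∀ (l : ℕ) {m n : ℕ} (s : PreSub V.C m n),
    S.whiskR l (Quot.mk _ s) = Quot.mk _ (s.whiskR l)) ∧
  (∀ m n : ℕ, S.sym m n = Quot.mk _ (PreSub.renCons (swapRen n m) PreSub.nil)) ∧
  (∀ n : ℕ, S.copy n = Quot.mk _ (PreSub.renCons (copyRen n) PreSub.nil)) ∧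
  (∀ n : ℕ, S.discard n = Quot.mk _ (PreSub.renCons (discardRen n) PreSub.nil))

/-- A pre-PROP structure on `SUB[C]` is induced by the substitution construction when
its identities, composition, whiskerings and symmetries are given on representatives by
the empty word, concatenation, stepwise padding and singleton renaming words. -/
def InducedC (P : SymRenPreoperad) (S : PrePROPOn (SUBQ P)) : Prop :=
  (∀ n : ℕ, S.id n = Quot.mk _ PreSub.nil) ∧
  (∀ {m k n : ℕ} (t : PreSub P.C m k) (s : PreSub P.C k n),
    S.comp (Quot.mk _ t) (Quot.mk _ s) = Quot.mk _ (s.append t)) ∧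
  (∀ (l : ℕ) {m n : ℕ} (s : PreSub P.C m n),
    S.whiskL l (Quot.mk _ s) = Quot.mk _ (s.whiskL l)) ∧
  (∀ (l : ℕ) {m n : ℕ} (s : PreSub P.C m n),
    S.whiskR l (Quot.mk _ s) = Quot.mk _ (s.whiskR l)) ∧
  (∀ m n : ℕ, S.sym m n = Quot.mk _ (PreSub.renCons (swapRen n m) PreSub.nil))

/-- A Freyd PROP structure on `(CSUB[V], SUB[C])` is induced by the substitution
construction when both components are and when `J` is given on representatives by
applying `I` to each substitution step of a word. -/
def Induced (O : FreydOperad) (S : FreydPROPOn (CSUBQ O.V) (SUBQ O.C)) : Prop :=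
  InducedV O.V S.Vp ∧ InducedC O.C S.Cp ∧
  (∀ {m n : ℕ} (s : PreSub O.V.C m n),
    S.J.map (Quot.mk _ s) = Quot.mk _ (PreSub.mapWord (fun {k} (g : O.V.C k) => O.I.map g) s))

/-- A Freyd PROP functor between induced substitution Freyd PROPs is induced by a Freyd
operad functor `φ` when it acts on representatives by applying `φ` to each substitution
step of a word. -/
def InducedHom {O₁ O₂ : FreydOperad} (φ : FreydOperadHom O₁ O₂)
    {A : FreydPROPOn (CSUBQ O₁.V) (SUBQ O₁.C)} {B : FreydPROPOn (CSUBQ O₂.V) (SUBQ O₂.C)}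
    (G : FreydPROPHomOn A B) : Prop :=
  (∀ {m n : ℕ} (s : PreSub O₁.V.C m n),
    G.mapV.map (Quot.mk _ s) =
      Quot.mk _ (PreSub.mapWord (fun {k} (g : O₁.V.C k) => φ.mapV.map g) s)) ∧
  (∀ {m n : ℕ} (s : PreSub O₁.C.C m n),
    G.mapC.map (Quot.mk _ s) =
      Quot.mk _ (PreSub.mapWord (fun {k} (g : O₁.C.C k) => φ.mapC.map g) s))

/-- Witness that the Freyd operad `O` is the Freyd operad of morphisms with codomain `1`
of the Freyd PROP `P`: the carriers are the hom-sets into `1`, operadic composition is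
given by whiskering and composition, reindexing by precomposition with the interpretation
of renamings (via `J` in the computation part), and `I` by restriction of `J`. -/
structure ForgetData (P : FreydPROP) (O : FreydOperad) where
  eV : ∀ n : ℕ, O.V.C n ≃ P.HV n 1
  eC : ∀ n : ℕ, O.C.C n ≃ P.HC n 1
  /-- interpretation of a renaming `r : m → n` as a morphism `n → m` of the value PROP -/
  interp : ∀ {m n : ℕ}, Ren m n → P.HV n m
  interp_id : ∀ n : ℕ, interp (idRen n) = P.str.Vp.id n
  interp_comp : ∀ {m n k : ℕ} (r₁ : Ren m n) (r₂ : Ren n k),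
    interp (r₂ ∘ r₁) = P.str.Vp.comp (interp r₂) (interp r₁)
  interp_swap : ∀ m n : ℕ, interp (swapRen m n) = P.str.Vp.sym n m
  interp_copy : ∀ n : ℕ, interp (copyRen n) = P.str.Vp.copy n
  interp_discard : ∀ n : ℕ, interp (discardRen n) = P.str.Vp.discard n
  interp_bsum : ∀ {m₁ n₁ m₂ n₂ : ℕ} (r : Ren m₁ n₁) (r' : Ren m₂ n₂),
    interp (bsum r r') = P.str.Vp.tens (interp r) (interp r')
  one_eV : eV 1 O.V.one = P.str.Vp.id 1
  one_eC : eC 1 O.C.one = P.str.Cp.id 1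
  subst_eV : ∀ {n₁ n₂ m : ℕ} (f : O.V.C (n₁ + 1 + n₂)) (g : O.V.C m),
    eV _ (O.V.subst n₁ n₂ f g) =
      hcast (H := P.HV) (by omega) rfl
        (P.str.Vp.comp (P.str.Vp.whiskL n₁ (P.str.Vp.whiskR n₂ (eV _ g)))
          (hcast (H := P.HV) (by omega) rfl (eV _ f)))
  subst_eC : ∀ {n₁ n₂ m : ℕ} (f : O.C.C (n₁ + 1 + n₂)) (g : O.C.C m),
    eC _ (O.C.subst n₁ n₂ f g) =
      hcast (H := P.HC) (by omega) rfl
        (P.str.Cp.comp (P.str.Cp.whiskL n₁ (P.str.Cp.whiskR n₂ (eC _ g)))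
          (hcast (H := P.HC) (by omega) rfl (eC _ f)))
  ren_eV : ∀ {m n : ℕ} (f : O.V.C m) (r : Ren m n),
    eV _ (O.V.ren f r) = P.str.Vp.comp (interp r) (eV _ f)
  ren_eC : ∀ {m n : ℕ} (f : O.C.C m) (r : Ren m n),
    eC _ (O.C.ren f r) = P.str.Cp.comp (P.str.J.map (interp r)) (eC _ f)
  J_compat : ∀ {n : ℕ} (v : O.V.C n), eC _ (O.I.map v) = P.str.J.map (eV _ v)

/-- Compatibility of a forgetful action on morphisms: the value and computation parts of
`φ` correspond, through the forgetful witnesses, to the restriction of `ψ` to morphisms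
with codomain `1`. -/
def UmorCompat {P₁ P₂ : FreydPROP} {O₁ O₂ : FreydOperad}
    (D₁ : ForgetData P₁ O₁) (D₂ : ForgetData P₂ O₂)
    (ψ : FreydPROPHomOn P₁.str P₂.str) (φ : FreydOperadHom O₁ O₂) : Prop :=
  (∀ {n : ℕ} (v : O₁.V.C n), D₂.eV n (φ.mapV.map v) = ψ.mapV.map (D₁.eV n v)) ∧
  (∀ {n : ℕ} (c : O₁.C.C n), D₂.eC n (φ.mapC.map c) = ψ.mapC.map (D₁.eC n c))

/-- Uncurrying (value part): interpret a substitution word in the value PROP, sending the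
empty word to the identity, a substitution step `⟨m₁ ⊣ g ⊢ m₂⟩` to the whiskered
morphism `m₁ ⋊ hV g ⋉ m₂`, and a renaming step to its interpretation, multiplicatively
over concatenation. -/
def uncurryV (O : FreydOperad) (P : FreydPROP)
    (interp : ∀ {a b : ℕ}, Ren a b → P.HV b a)
    (hV : ∀ {k : ℕ}, O.V.C k → P.HV k 1) :
    ∀ {m n : ℕ}, PreSub O.V.C m n → P.HV m n
  | _, _, .nil => P.str.Vp.id _
  | _, _, .subCons m₁ m₂ g rest =>
      P.str.Vp.comp (uncurryV O P interp hV rest)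
        (hcast (H := P.HV) (by omega) (by omega)
          (P.str.Vp.whiskL m₁ (P.str.Vp.whiskR m₂ (hV g))))
  | _, _, .renCons r rest =>
      P.str.Vp.comp (uncurryV O P interp hV rest) (interp r)

/-- Uncurrying (computation part): interpret a substitution word in the computation
pre-PROP, renaming steps being interpreted via `J` applied to their value
interpretation. -/
def uncurryC (O : FreydOperad) (P : FreydPROP)
    (iren : ∀ {a b : ℕ}, Ren a b → P.HC b a)
    (hC : ∀ {k : ℕ}, O.C.C k → P.HC k 1) :
    ∀ {m n : ℕ}, PreSub O.C.C m n → P.HC m n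
  | _, _, .nil => P.str.Cp.id _
  | _, _, .subCons m₁ m₂ g rest =>
      P.str.Cp.comp (uncurryC O P iren hC rest)
        (hcast (H := P.HC) (by omega) (by omega)
          (P.str.Cp.whiskL m₁ (P.str.Cp.whiskR m₂ (hC g))))
  | _, _, .renCons r rest =>
      P.str.Cp.comp (uncurryC O P iren hC rest) (iren r)

theorem idRen_apply (n : ℕ) (i : Fin n) : idRen n i = i := rfl

theorem bsum_val {m₁ n₁ m₂ n₂ : ℕ} (r : Ren m₁ n₁) (r' : Ren m₂ n₂) (i : Fin (m₁ + m₂)) :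
    (bsum r r' i : ℕ) =
      if h : (i : ℕ) < m₁ then (r ⟨i, h⟩ : ℕ) else n₁ + (r' ⟨i - m₁, by omega⟩ : ℕ) := by
  refine Fin.addCases (fun a => ?_) (fun b => ?_) i
  · simp [bsum]
  · simp [bsum]

theorem swapRen_val (m n : ℕ) (i : Fin (m + n)) :
    (swapRen m n i : ℕ) = if (i : ℕ) < m then n + i else i - m := by
  refine Fin.addCases (fun a => ?_) (fun b => ?_) i
  · simp [swapRen]
  · simp [swapRen]

/-- Cast of a renaming along equalities of its arities. -/
def Ren.cast {a a' b b' : ℕ} (h : a = a') (h' : b = b') (r : Ren a b) : Ren a' b' :=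
  fun i => (r (i.cast h.symm)).cast h'

theorem Ren.cast_val {a a' b b' : ℕ} (h : a = a') (h' : b = b') (r : Ren a b) (i : Fin a') :
    (r.cast h h' i : ℕ) = r (i.cast h.symm) := rfl

theorem Ren.ext_val {a b : ℕ} {r s : Ren a b} (h : ∀ i, (r i : ℕ) = s i) : r = s :=
  funext fun i => Fin.ext (h i)

namespace PreSub

variable {C : ℕ → Type}

/-- Cast a pre-substitution along equalities of both arities. -/
def cast {m m' n n' : ℕ} (h : m = m') (h' : n = n') (s : PreSub C m n) : PreSub C m' n' :=
  h ▸ h' ▸ s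

/-- A substitution step whose arities are only propositionally of the required form. -/
def subStep {m a b : ℕ} (m₁ m₂ : ℕ) {k : ℕ} (ha : m₁ + 1 + m₂ = a) (hb : b = m₁ + k + m₂)
    (g : C k) (rest : PreSub C m b) : PreSub C m a :=
  castU ha (.subCons m₁ m₂ g (castU hb rest))

theorem subCons_eq_subStep {m : ℕ} (m₁ m₂ : ℕ) {k : ℕ} (g : C k)
    (rest : PreSub C m (m₁ + k + m₂)) :
    subCons m₁ m₂ g rest = subStep m₁ m₂ rfl rfl g rest := rfl

theorem castU_subStep {m a a' b : ℕ} (m₁ m₂ : ℕ) {k : ℕ} (ha : m₁ + 1 + m₂ = a)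
    (hb : b = m₁ + k + m₂) (g : C k) (rest : PreSub C m b) (h : a = a') :
    castU h (subStep m₁ m₂ ha hb g rest) = subStep m₁ m₂ (ha.trans h) hb g rest := by
  subst h; rfl

theorem subStep_castU {m a b b' : ℕ} (m₁ m₂ : ℕ) {k : ℕ} (ha : m₁ + 1 + m₂ = a)
    (hb : b' = m₁ + k + m₂) (g : C k) (rest : PreSub C m b) (h : b = b') :
    subStep m₁ m₂ ha hb g (castU h rest) = subStep m₁ m₂ ha (h.trans hb) g rest := by
  subst h; rfl

theorem castU_renCons {m a a' b : ℕ} (r : Ren a b) (rest : PreSub C m b) (h : a = a') :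
    castU h (renCons r rest) = renCons (r.cast h rfl) rest := by
  subst h; rfl

theorem renCons_castU {m a b b' : ℕ} (r : Ren a b') (rest : PreSub C m b) (h : b = b') :
    renCons r (castU h rest) = renCons (r.cast rfl h.symm) rest := by
  subst h; rfl

theorem castU_append {m k n n' : ℕ} (s : PreSub C k n) (t : PreSub C m k) (h : n = n') :
    (castU h s).append t = castU h (s.append t) := by
  subst h; rfl

theorem cast_subStep {m m' a a' b : ℕ} (m₁ m₂ : ℕ) {k : ℕ} (ha : m₁ + 1 + m₂ = a)
    (hb : b = m₁ + k + m₂) (g : C k) (rest : PreSub C m b) (h : m = m') (h' : a = a') :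
    cast h h' (subStep m₁ m₂ ha hb g rest) =
      subStep m₁ m₂ (ha.trans h') hb g (cast h rfl rest) := by
  subst h h'; rfl

theorem subStep_cast {m m' a b b' : ℕ} (m₁ m₂ : ℕ) {k : ℕ} (ha : m₁ + 1 + m₂ = a)
    (hb : b' = m₁ + k + m₂) (g : C k) (rest : PreSub C m b) (h : m = m') (h' : b = b') :
    subStep m₁ m₂ ha hb g (cast h h' rest) =
      subStep m₁ m₂ ha (h'.trans hb) g (cast h rfl rest) := by
  subst h h'; rfl

theorem subStep_congr {m a b m₁ m₂ m₁' m₂' : ℕ} {k : ℕ} (ha : m₁ + 1 + m₂ = a)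
    (hb : b = m₁ + k + m₂) (g : C k) {rest rest' : PreSub C m b} (h₁ : m₁ = m₁') (h₂ : m₂ = m₂')
    (h : rest = rest') :
    subStep m₁ m₂ ha hb g rest =
      subStep m₁' m₂' (by omega) (by omega) g rest' := by
  subst h₁ h₂ h; rfl

theorem cast_renCons {m m' a a' b : ℕ} (r : Ren a b) (rest : PreSub C m b) (h : m = m')
    (h' : a = a') :
    cast h h' (renCons r rest) = renCons (r.cast h' rfl) (cast h rfl rest) := by
  subst h h'; rfl

theorem renCons_cast {m m' a b b' : ℕ} (r : Ren a b') (rest : PreSub C m b) (h : m = m')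
    (h' : b = b') :
    renCons r (cast h h' rest) = renCons (r.cast rfl h'.symm) (cast h rfl rest) := by
  subst h h'; rfl

theorem nil_append {m n : ℕ} (t : PreSub C m n) : append nil t = t := by rw [append]

theorem subCons_append {m l : ℕ} (m₁ m₂ : ℕ) {k : ℕ} (g : C k)
    (rest : PreSub C m (m₁ + k + m₂)) (t : PreSub C l m) :
    (subCons m₁ m₂ g rest).append t = subCons m₁ m₂ g (rest.append t) := by rw [append]

theorem renCons_append {m l a b : ℕ} (r : Ren a b) (rest : PreSub C m b) (t : PreSub C l m) :
    (renCons r rest).append t = renCons r (rest.append t) := by rw [append]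

theorem whiskL_nil (l n : ℕ) : whiskL l (nil : PreSub C n n) = nil := by rw [whiskL]

theorem whiskR_nil (l n : ℕ) : whiskR l (nil : PreSub C n n) = nil := by rw [whiskR]

theorem whiskL_renCons (l : ℕ) {m a b : ℕ} (r : Ren a b) (rest : PreSub C m b) :
    whiskL l (renCons r rest) = renCons (bsum (idRen l) r) (whiskL l rest) := by rw [whiskL]

theorem whiskR_renCons (l : ℕ) {m a b : ℕ} (r : Ren a b) (rest : PreSub C m b) :
    whiskR l (renCons r rest) = renCons (bsum r (idRen l)) (whiskR l rest) := by rw [whiskR]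

theorem subStep_append {m l a b : ℕ} (m₁ m₂ : ℕ) {k : ℕ} (ha : m₁ + 1 + m₂ = a)
    (hb : b = m₁ + k + m₂) (g : C k) (rest : PreSub C m b) (t : PreSub C l m) :
    (subStep m₁ m₂ ha hb g rest).append t = subStep m₁ m₂ ha hb g (rest.append t) := by
  subst ha hb; exact subCons_append m₁ m₂ g rest t

theorem whiskL_subStep (l : ℕ) {m a b : ℕ} (m₁ m₂ : ℕ) {k : ℕ} (ha : m₁ + 1 + m₂ = a)
    (hb : b = m₁ + k + m₂) (g : C k) (rest : PreSub C m b) :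
    whiskL l (subStep m₁ m₂ ha hb g rest) =
      subStep (l + m₁) m₂ (by omega) (by omega) g (whiskL l rest) := by
  subst ha hb; exact whiskL.eq_2 ..

theorem whiskR_subStep (l : ℕ) {m a b : ℕ} (m₁ m₂ : ℕ) {k : ℕ} (ha : m₁ + 1 + m₂ = a)
    (hb : b = m₁ + k + m₂) (g : C k) (rest : PreSub C m b) :
    whiskR l (subStep m₁ m₂ ha hb g rest) =
      subStep m₁ (m₂ + l) (by omega) (by omega) g (whiskR l rest) := by
  subst ha hb; exact whiskR.eq_2 ..

theorem append_nil {m n : ℕ} (s : PreSub C m n) : s.append nil = s := by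
  induction s with
  | nil => exact nil_append _
  | subCons m₁ m₂ g rest ih => rw [subCons_append, ih]
  | renCons r rest ih => rw [renCons_append, ih]

theorem append_assoc {a b c d : ℕ} (s : PreSub C c d) (t : PreSub C b c) (u : PreSub C a b) :
    (s.append t).append u = s.append (t.append u) := by
  induction s with
  | nil => simp only [nil_append]
  | subCons m₁ m₂ g rest ih => simp only [subCons_append, ih]
  | renCons r rest ih => simp only [renCons_append, ih]

theorem whiskL_append (l : ℕ) {a b c : ℕ} (s : PreSub C b c) (t : PreSub C a b) :
    whiskL l (s.append t) = (whiskL l s).append (whiskL l t) := by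
  induction s with
  | nil => simp only [nil_append, whiskL_nil]
  | subCons m₁ m₂ g rest ih =>
    simp only [subCons_eq_subStep, subStep_append, whiskL_subStep, ih]
  | renCons r rest ih => simp only [renCons_append, whiskL_renCons, ih]

theorem whiskR_append (l : ℕ) {a b c : ℕ} (s : PreSub C b c) (t : PreSub C a b) :
    whiskR l (s.append t) = (whiskR l s).append (whiskR l t) := by
  induction s with
  | nil => simp only [nil_append, whiskR_nil]
  | subCons m₁ m₂ g rest ih =>
    simp only [subCons_eq_subStep, subStep_append, whiskR_subStep, ih]
  | renCons r rest ih => simp only [renCons_append, whiskR_renCons, ih]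

theorem cast_nil {n n' : ℕ} (h h' : n = n') : cast h h' (nil : PreSub C n n) = nil := by
  subst h; rfl

theorem renCons_congr {m a b : ℕ} {r r' : Ren a b} {s s' : PreSub C m b}
    (h : ∀ i, (r i : ℕ) = r' i) (hs : s = s') : renCons r s = renCons r' s' := by
  rw [Ren.ext_val h, hs]

theorem whiskL_zero {m n : ℕ} (s : PreSub C m n) :
    whiskL 0 s = cast (by omega) (by omega) s := by
  induction s with
  | nil => rw [cast_nil, whiskL_nil]
  | subCons m₁ m₂ g rest ih =>
    simp only [subCons_eq_subStep, whiskL_subStep, ih, cast_subStep]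
    rw [subStep_cast]
    exact subStep_congr _ _ _ (by omega) rfl rfl
  | renCons r rest ih =>
    simp only [whiskL_renCons, ih, cast_renCons]
    rw [renCons_cast]
    refine renCons_congr (fun i => ?_) rfl
    simp [bsum_val, Ren.cast_val, Fin.cast]

theorem whiskR_zero {m n : ℕ} (s : PreSub C m n) : whiskR 0 s = s := by
  induction s with
  | nil => exact whiskR_nil 0 _
  | subCons m₁ m₂ g rest ih =>
    simp only [subCons_eq_subStep, whiskR_subStep, ih]
    exact subStep_congr _ _ _ rfl (by omega) rfl
  | renCons r rest ih =>
    simp only [whiskR_renCons, ih]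
    refine renCons_congr (fun i => ?_) rfl
    simp [bsum_val]

theorem whiskL_add (k l : ℕ) {m n : ℕ} (s : PreSub C m n) :
    whiskL k (whiskL l s) = cast (by omega) (by omega) (whiskL (k + l) s) := by
  induction s with
  | nil => simp only [whiskL_nil, cast_nil]
  | subCons m₁ m₂ g rest ih =>
    simp only [subCons_eq_subStep, whiskL_subStep, ih, cast_subStep]
    rw [subStep_cast]
    exact subStep_congr _ _ _ (by omega) rfl rfl
  | renCons r rest ih =>
    simp only [whiskL_renCons, ih, cast_renCons]
    rw [renCons_cast]
    refine renCons_congr (fun i => ?_) rfl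
    simp only [bsum_val, Ren.cast_val, Fin.cast, idRen_apply, Nat.sub_sub]
    split_ifs <;> omega

theorem whiskR_add (k l : ℕ) {m n : ℕ} (s : PreSub C m n) :
    whiskR l (whiskR k s) = cast (by omega) (by omega) (whiskR (k + l) s) := by
  induction s with
  | nil => simp only [whiskR_nil, cast_nil]
  | subCons m₁ m₂ g rest ih =>
    simp only [subCons_eq_subStep, whiskR_subStep, ih, cast_subStep]
    rw [subStep_cast]
    exact subStep_congr _ _ _ rfl (by omega) rfl
  | renCons r rest ih =>
    simp only [whiskR_renCons, ih, cast_renCons]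
    rw [renCons_cast]
    refine renCons_congr (fun i => ?_) rfl
    simp only [bsum_val, Ren.cast_val, Fin.cast, idRen_apply]
    split_ifs <;> omega

theorem whisk_exch (k l : ℕ) {m n : ℕ} (s : PreSub C m n) :
    whiskL k (whiskR l s) = cast (by omega) (by omega) (whiskR l (whiskL k s)) := by
  induction s with
  | nil => simp only [whiskL_nil, whiskR_nil, cast_nil]
  | subCons m₁ m₂ g rest ih =>
    simp only [subCons_eq_subStep, whiskL_subStep, whiskR_subStep, ih, cast_subStep]
    rw [subStep_cast]
  | renCons r rest ih =>
    simp only [whiskL_renCons, whiskR_renCons, ih, cast_renCons]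
    rw [renCons_cast]
    refine renCons_congr (fun i => ?_) rfl
    simp only [bsum_val, Ren.cast_val, Fin.cast, idRen_apply]
    split_ifs <;> omega

end PreSub

namespace SubEquiv

open PreSub

variable {P : SymRenPreoperad}

theorem castU_congr {m n n' : ℕ} (h : n = n') {s t : PreSub P.C m n} (hst : SubEquiv P s t) :
    SubEquiv P (castU h s) (castU h t) := by
  subst h; exact hst

theorem subStep_congr {m a b m₁ m₂ k : ℕ} (ha : m₁ + 1 + m₂ = a) (hb : b = m₁ + k + m₂)
    (g : P.C k) {s t : PreSub P.C m b} (h : SubEquiv P s t) :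
    SubEquiv P (subStep m₁ m₂ ha hb g s) (subStep m₁ m₂ ha hb g t) := by
  subst ha hb; exact congrSub g h

theorem subStep_one {m a m₁ m₂ : ℕ} (ha : m₁ + 1 + m₂ = a) (hb : a = m₁ + 1 + m₂)
    (s : PreSub P.C m a) : SubEquiv P (subStep m₁ m₂ ha hb P.one s) s := by
  subst ha; exact unit₁ s

theorem subStep_merge {m m₁ m₂ n₁ n₂ k a b c p q : ℕ} (g : P.C (n₁ + 1 + n₂)) (h : P.C k)
    (rest : PreSub P.C m c) (hp : p = m₁ + n₁) (hq : q = n₂ + m₂)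
    (ha : m₁ + 1 + m₂ = a) (hb : b = m₁ + (n₁ + 1 + n₂) + m₂) (hb' : p + 1 + q = b)
    (hc : c = p + k + q) (hc' : c = m₁ + (n₁ + k + n₂) + m₂) :
    SubEquiv P (subStep m₁ m₂ ha hb g (subStep p q hb' hc h rest))
      (subStep m₁ m₂ ha hc' (P.subst n₁ n₂ g h) rest) := by
  subst hp hq ha hb' hc
  exact merge g h rest

theorem renCons_renCons {m a b c : ℕ} (r₁ : Ren a b) (r₂ : Ren b c) (r : Ren a c)
    (rest : PreSub P.C m c) (h : ∀ i, (r i : ℕ) = r₂ (r₁ i)) :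
    SubEquiv P (.renCons r₁ (.renCons r₂ rest)) (.renCons r rest) := by
  obtain rfl : r = r₂ ∘ r₁ := Ren.ext_val h
  exact renComp r₁ r₂ rest

theorem renCons_id {m n : ℕ} (r : Ren n n) (h : ∀ i, (r i : ℕ) = i) (s : PreSub P.C m n) :
    SubEquiv P (.renCons r s) s := by
  obtain rfl : r = idRen n := Ren.ext_val h
  exact unit₂ s

theorem subStep_interchange {m n₁ n₂ k a b c x x' y y' : ℕ} (v : P.C k)
    (ρ₁ : Ren n₁ a) (ρ : Ren k b) (ρ₂ : Ren n₂ c) (R : Ren x x') (R' : Ren y y')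
    (rest : PreSub P.C m x') (hx : x = n₁ + k + n₂) (hx' : x' = a + b + c)
    (hy : n₁ + 1 + n₂ = y) (hy' : a + 1 + c = y')
    (hR : ∀ i, (R i : ℕ) = bsum (bsum ρ₁ ρ) ρ₂ (i.cast hx))
    (hR' : ∀ i, (R' i : ℕ) = bsum (bsum ρ₁ (idRen 1)) ρ₂ (i.cast hy.symm)) :
    SubEquiv P (subStep n₁ n₂ hy hx v (.renCons R rest))
      (.renCons R' (subStep a c hy' hx' (P.ren v ρ) rest)) := by
  subst hx hx' hy hy'
  obtain rfl : R = bsum (bsum ρ₁ ρ) ρ₂ := Ren.ext_val hR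
  obtain rfl : R' = bsum (bsum ρ₁ (idRen 1)) ρ₂ := Ren.ext_val hR'
  exact interchange v ρ₁ ρ ρ₂ rest

theorem subStep_symL {m m₁ m₂ n x y z w p q : ℕ} (g : P.C n) (R : Ren x y) (R' : Ren z w)
    (rest : PreSub P.C m w) (hp : p = m₁ + 1) (hq : q = 1 + m₂)
    (hx : p + 1 + m₂ = x) (hy : m₁ + 1 + q = y) (hz : z = p + n + m₂) (hw : w = m₁ + n + q)
    (hR : ∀ i, (R i : ℕ) =
      if (i : ℕ) = m₁ then m₁ + 1 else if (i : ℕ) = m₁ + 1 then m₁ else i)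
    (hR' : ∀ i, (R' i : ℕ) =
      if (i : ℕ) < m₁ then (i : ℕ) else if (i : ℕ) = m₁ then m₁ + n
        else if (i : ℕ) < m₁ + 1 + n then i - 1 else i) :
    SubEquiv P (.renCons R (subStep m₁ q hy hw g rest))
      (subStep p m₂ hx hz g (.renCons R' rest)) := by
  subst hp hq hx hy hz hw
  have key := symL (m₁ := m₁) (m₂ := m₂) g rest
  simp only [renCons_castU, castU_renCons] at key
  obtain rfl : R = (bsum (bsum (idRen m₁) (swapRen 1 1)) (idRen m₂)).cast rfl (by omega) := by
    refine Ren.ext_val fun i => ?_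
    simp only [hR, bsum_val, idRen_apply, swapRen_val, Ren.cast_val, Fin.cast]
    grind
  obtain rfl : R' = (bsum (bsum (idRen m₁) (swapRen 1 n)) (idRen m₂)).cast
      (by omega) (by omega) := by
    refine Ren.ext_val fun i => ?_
    simp only [hR', bsum_val, idRen_apply, swapRen_val, Ren.cast_val, Fin.cast]
    grind
  exact key

theorem subStep_symR {m m₁ m₂ n x y z w p q : ℕ} (g : P.C n) (R : Ren x y) (R' : Ren z w)
    (rest : PreSub P.C m w) (hp : p = m₁ + 1) (hq : q = 1 + m₂)
    (hx : m₁ + 1 + q = x) (hy : p + 1 + m₂ = y) (hz : z = m₁ + n + q) (hw : w = p + n + m₂)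
    (hR : ∀ i, (R i : ℕ) =
      if (i : ℕ) = m₁ then m₁ + 1 else if (i : ℕ) = m₁ + 1 then m₁ else i)
    (hR' : ∀ i, (R' i : ℕ) =
      if (i : ℕ) < m₁ then (i : ℕ) else if (i : ℕ) < m₁ + n then i + 1
        else if (i : ℕ) = m₁ + n then m₁ else i) :
    SubEquiv P (.renCons R (subStep p m₂ hy hw g rest))
      (subStep m₁ q hx hz g (.renCons R' rest)) := by
  subst hp hq hx hy hz hw
  have key := castU_congr (show m₁ + (1 + 1) + m₂ = m₁ + 1 + (1 + m₂) by omega)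
    (symR (m₁ := m₁) (m₂ := m₂) g rest)
  simp only [subCons_eq_subStep, castU_subStep, renCons_castU, castU_renCons] at key
  obtain rfl : R = (bsum (bsum (idRen m₁) (swapRen 1 1)) (idRen m₂)).cast (by omega) rfl := by
    refine Ren.ext_val fun i => ?_
    simp only [hR, bsum_val, idRen_apply, swapRen_val, Ren.cast_val, Fin.cast]
    grind
  obtain rfl : R' = (bsum (bsum (idRen m₁) (swapRen n 1)) (idRen m₂)).cast
      (by omega) (by omega) := by
    refine Ren.ext_val fun i => ?_
    simp only [hR', bsum_val, idRen_apply, swapRen_val, Ren.cast_val, Fin.cast]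
    grind
  exact key

theorem append_congr_left {a b c : ℕ} {s s' : PreSub P.C b c} (t : PreSub P.C a b)
    (h : SubEquiv P s s') : SubEquiv P (s.append t) (s'.append t) := by
  induction h with
  | refl s => exact refl _
  | symm _ ih => exact ih.symm
  | trans _ _ ih₁ ih₂ => exact ih₁.trans ih₂
  | congrSub g _ ih => simpa only [subCons_append] using congrSub g ih
  | congrRen r _ ih => simpa only [renCons_append] using congrRen r ih
  | unit₁ s => simpa only [subCons_append] using unit₁ _
  | unit₂ s => simpa only [renCons_append] using unit₂ _
  | merge g h rest =>
    simpa only [subCons_append, castU_append] using merge g h (rest.append t)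
  | renComp r₁ r₂ rest => simpa only [renCons_append] using renComp r₁ r₂ _
  | interchange v ρ₁ ρ ρ₂ rest =>
    simpa only [subCons_append, renCons_append] using interchange v ρ₁ ρ ρ₂ _
  | symL g rest =>
    simpa only [subCons_append, renCons_append, castU_append] using symL g (rest.append t)
  | symR g rest =>
    simpa only [subCons_append, renCons_append, castU_append] using symR g (rest.append t)

theorem append_congr_right {a b c : ℕ} (s : PreSub P.C b c) {t t' : PreSub P.C a b}
    (h : SubEquiv P t t') : SubEquiv P (s.append t) (s.append t') := by
  induction s with
  | nil => simpa only [nil_append] using h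
  | subCons m₁ m₂ g rest ih => simpa only [subCons_append] using congrSub g ih
  | renCons r rest ih => simpa only [renCons_append] using congrRen r ih

theorem whiskL_congr (l : ℕ) {m n : ℕ} {s t : PreSub P.C m n} (h : SubEquiv P s t) :
    SubEquiv P (s.whiskL l) (t.whiskL l) := by
  induction h with
  | refl s => exact refl _
  | symm _ ih => exact ih.symm
  | trans _ _ ih₁ ih₂ => exact ih₁.trans ih₂
  | congrSub g _ ih =>
    simpa only [subCons_eq_subStep, whiskL_subStep] using subStep_congr _ _ g ih
  | congrRen r _ ih => simpa only [whiskL_renCons] using congrRen _ ih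
  | unit₁ s => simpa only [subCons_eq_subStep, whiskL_subStep] using subStep_one _ _ _
  | unit₂ s =>
    rw [whiskL_renCons]
    refine renCons_id _ (fun i => ?_) _
    simp only [bsum_val, idRen_apply]
    split_ifs <;> omega
  | merge g h rest =>
    simp only [subCons_eq_subStep, castU_subStep, subStep_castU, whiskL_subStep]
    exact subStep_merge _ _ _ (by omega) rfl _ _ _ _ _
  | renComp r₁ r₂ rest =>
    simp only [whiskL_renCons]
    refine renCons_renCons _ _ _ _ fun i => ?_
    simp only [bsum_val, idRen_apply, Function.comp]
    split_ifs <;> first | omega | simp_all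
  | interchange v ρ₁ ρ ρ₂ rest =>
    simp only [subCons_eq_subStep, whiskL_subStep, whiskL_renCons]
    refine subStep_interchange v (bsum (idRen l) ρ₁) ρ ρ₂ _ _ _ _ _ _ _ (fun i => ?_) fun i => ?_
    · simp only [bsum_val, idRen_apply, Fin.cast]
      grind
    · simp only [bsum_val, idRen_apply, Fin.cast]
      grind
  | symL g rest =>
    simp only [subCons_eq_subStep, castU_subStep, whiskL_subStep, whiskL_renCons,
      castU_renCons, renCons_castU]
    refine subStep_symL g _ _ _ (by omega) rfl _ _ _ _ (fun i => ?_) fun i => ?_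
    · simp only [bsum_val, idRen_apply, swapRen_val]
      grind
    · simp only [bsum_val, idRen_apply, Ren.cast_val, swapRen_val, Fin.cast]
      grind
  | symR g rest =>
    simp only [subCons_eq_subStep, castU_subStep, subStep_castU, whiskL_subStep, whiskL_renCons,
      castU_renCons, renCons_castU]
    refine subStep_symR g _ _ _ (by omega) rfl _ _ _ _ (fun i => ?_) fun i => ?_
    · simp only [bsum_val, idRen_apply, swapRen_val]
      grind
    · simp only [bsum_val, idRen_apply, Ren.cast_val, swapRen_val, Fin.cast]
      grind

theorem whiskR_congr (l : ℕ) {m n : ℕ} {s t : PreSub P.C m n} (h : SubEquiv P s t) :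
    SubEquiv P (s.whiskR l) (t.whiskR l) := by
  induction h with
  | refl s => exact refl _
  | symm _ ih => exact ih.symm
  | trans _ _ ih₁ ih₂ => exact ih₁.trans ih₂
  | congrSub g _ ih =>
    simpa only [subCons_eq_subStep, whiskR_subStep] using subStep_congr _ _ g ih
  | congrRen r _ ih => simpa only [whiskR_renCons] using congrRen _ ih
  | unit₁ s => simpa only [subCons_eq_subStep, whiskR_subStep] using subStep_one _ _ _
  | unit₂ s =>
    rw [whiskR_renCons]
    refine renCons_id _ (fun i => ?_) _
    simp only [bsum_val, idRen_apply]
    split_ifs <;> omega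
  | merge g h rest =>
    simp only [subCons_eq_subStep, castU_subStep, subStep_castU, whiskR_subStep]
    exact subStep_merge _ _ _ rfl (by omega) _ _ _ _ _
  | renComp r₁ r₂ rest =>
    simp only [whiskR_renCons]
    refine renCons_renCons _ _ _ _ fun i => ?_
    simp only [bsum_val, idRen_apply, Function.comp]
    split_ifs <;> first | omega | simp_all
  | interchange v ρ₁ ρ ρ₂ rest =>
    simp only [subCons_eq_subStep, whiskR_subStep, whiskR_renCons]
    refine subStep_interchange v ρ₁ ρ (bsum ρ₂ (idRen l)) _ _ _ _ _ _ _ (fun i => ?_) fun i => ?_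
    · simp only [bsum_val, idRen_apply, Fin.cast]
      grind
    · simp only [bsum_val, idRen_apply, Fin.cast]
      grind
  | symL g rest =>
    simp only [subCons_eq_subStep, castU_subStep, whiskR_subStep, whiskR_renCons,
      castU_renCons, renCons_castU]
    refine subStep_symL g _ _ _ rfl (by omega) _ _ _ _ (fun i => ?_) fun i => ?_
    · simp only [bsum_val, idRen_apply, swapRen_val]
      grind
    · simp only [bsum_val, idRen_apply, Ren.cast_val, swapRen_val, Fin.cast]
      grind
  | symR g rest =>
    simp only [subCons_eq_subStep, castU_subStep, subStep_castU, whiskR_subStep, whiskR_renCons,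
      castU_renCons, renCons_castU]
    refine subStep_symR g _ _ _ rfl (by omega) _ _ _ _ (fun i => ?_) fun i => ?_
    · simp only [bsum_val, idRen_apply, swapRen_val]
      grind
    · simp only [bsum_val, idRen_apply, Ren.cast_val, swapRen_val, Fin.cast]
      grind

/-- A renaming that fixes the substituted block passes through a substitution step. -/
theorem renCons_subStep {m n₁ n₂ k a c x x' y y' : ℕ} (v : P.C k)
    (ρ₁ : Ren n₁ a) (ρ₂ : Ren n₂ c) (R : Ren x x') (R' : Ren y y')
    (rest : PreSub P.C m x') (hx : x = n₁ + k + n₂) (hx' : x' = a + k + c)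
    (hy : n₁ + 1 + n₂ = y) (hy' : a + 1 + c = y')
    (hR : ∀ i, (R i : ℕ) = bsum (bsum ρ₁ (idRen k)) ρ₂ (i.cast hx))
    (hR' : ∀ i, (R' i : ℕ) = bsum (bsum ρ₁ (idRen 1)) ρ₂ (i.cast hy.symm)) :
    SubEquiv P (.renCons R' (subStep a c hy' hx' v rest))
      (subStep n₁ n₂ hy hx v (.renCons R rest)) := by
  have key := subStep_interchange v ρ₁ (idRen k) ρ₂ R R' rest hx hx' hy hy' hR hR'
  rw [P.ren_id] at key
  exact key.symm

/-- A block of `j` variables slides past a substitution step. -/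
theorem subStep_slide {m p j q n x y z w p' q' : ℕ} (g : P.C n) (R : Ren x y) (R' : Ren z w)
    (rest : PreSub P.C m w) (hp : p' = p + j) (hq : q' = j + q)
    (hx : p' + 1 + q = x) (hy : p + 1 + q' = y) (hz : z = p' + n + q) (hw : w = p + n + q')
    (hR : ∀ i, (R i : ℕ) =
      if (i : ℕ) < p then (i : ℕ) else if (i : ℕ) < p + j then i + 1
        else if (i : ℕ) = p + j then p else i)
    (hR' : ∀ i, (R' i : ℕ) =
      if (i : ℕ) < p then (i : ℕ) else if (i : ℕ) < p + j then i + n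
        else if (i : ℕ) < p + j + n then i - j else i) :
    SubEquiv P (.renCons R (subStep p q' hy hw g rest))
      (subStep p' q hx hz g (.renCons R' rest)) := by
  induction j generalizing q x z p' with
  | zero =>
    obtain rfl : p = p' := hp.symm
    obtain rfl : q = q' := by omega
    subst hx hz hw
    obtain rfl : y = p + 1 + q := hy.symm
    refine (renCons_id _ (fun i => ?_) _).trans
      (subStep_congr _ _ g (renCons_id _ (fun i => ?_) _).symm)
    · rw [hR]; grind
    · rw [hR']; grind
  | succ j ih =>
    let T : Ren x (p + j + 1 + (1 + q)) :=
      (bsum (bsum (idRen (p + j)) (swapRen 1 1)) (idRen q)).cast (by omega) (by omega)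
    let T' : Ren z (p + j + n + (1 + q)) :=
      (bsum (bsum (idRen (p + j)) (swapRen 1 n)) (idRen q)).cast (by omega) (by omega)
    let U : Ren (p + j + 1 + (1 + q)) y :=
      (bsum (bsum (idRen p) (swapRen j 1)) (idRen (1 + q))).cast (by omega) (by omega)
    let U' : Ren (p + j + n + (1 + q)) w :=
      (bsum (bsum (idRen p) (swapRen j n)) (idRen (1 + q))).cast (by omega) (by omega)
    refine (renCons_renCons T U R _ fun i => ?_).symm.trans ?_
    · simp only [T, U, hR, bsum_val, idRen_apply, swapRen_val, Ren.cast_val, Fin.cast]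
      grind
    refine (congrRen T (ih (q := 1 + q) (p' := p + j) U U' rfl (by omega) rfl rfl
      (fun i => ?_) fun i => ?_)).trans ?_
    · simp only [U, bsum_val, idRen_apply, swapRen_val, Ren.cast_val, Fin.cast]
      grind
    · simp only [U', bsum_val, idRen_apply, swapRen_val, Ren.cast_val, Fin.cast]
      grind
    refine (subStep_symL g T T' _ (by omega) rfl hx rfl hz rfl (fun i => ?_)
      fun i => ?_).trans ?_
    · simp only [T, bsum_val, idRen_apply, swapRen_val, Ren.cast_val, Fin.cast]
      grind
    · simp only [T', bsum_val, idRen_apply, swapRen_val, Ren.cast_val, Fin.cast]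
      grind
    refine subStep_congr _ _ g (renCons_renCons T' U' R' _ fun i => ?_)
    simp only [T', U', hR', bsum_val, idRen_apply, swapRen_val, Ren.cast_val, Fin.cast]
    grind

theorem swapRen_subStep {m a b n m₁ m₂ : ℕ} (k : ℕ) (g : P.C n) (rest : PreSub P.C m (b + k))
    (ha : m₁ + 1 + m₂ = a) (hb : b = m₁ + n + m₂) :
    SubEquiv P (.renCons (swapRen k a) (subStep m₁ (m₂ + k) (by omega) (by omega) g rest))
      (subStep (k + m₁) m₂ (by omega) (by omega) g (.renCons (swapRen k b) rest)) := by
  let A (t : ℕ) : Ren (k + m₁ + t + m₂) (m₁ + k + t + m₂) :=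
    bsum (bsum (swapRen k m₁) (idRen t)) (idRen m₂)
  let B (t : ℕ) : Ren (m₁ + k + t + m₂) (m₁ + t + (k + m₂)) :=
    (bsum (bsum (idRen m₁) (swapRen k t)) (idRen m₂)).cast (by omega) (by omega)
  let D (t : ℕ) : Ren (m₁ + t + (k + m₂)) (m₁ + t + (m₂ + k)) :=
    bsum (bsum (idRen m₁) (idRen t)) (swapRen k m₂)
  have hABD (t c : ℕ) (h : c = m₁ + t + m₂) (i : Fin (k + c)) :
      (swapRen k c i : ℕ) = D t (B t (A t (i.cast (by omega)))) := by
    simp only [A, B, D, bsum_val, idRen_apply, swapRen_val, Ren.cast_val, Fin.cast]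
    grind
  have hfactor (t c : ℕ) (h : c = m₁ + t + m₂) (s : PreSub P.C m (c + k)) :
      SubEquiv P (.renCons (swapRen k c) s)
        (.renCons ((A t).cast (by omega) rfl) (.renCons (B t)
          (.renCons ((D t).cast rfl (by omega)) s))) :=
    ((congrRen ((A t).cast (by omega) rfl) (renCons_renCons (B t) ((D t).cast rfl (by omega))
      ((D t).cast rfl (by omega) ∘ B t) s fun _ => rfl)).trans
      (renCons_renCons _ _ (swapRen k c) s (hABD t c h))).symm
  refine (hfactor 1 a ha.symm _).trans (.trans ?_ (subStep_congr _ _ g (hfactor n b hb _).symm))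
  have hD := renCons_subStep (y' := a + k) g (idRen m₁) (swapRen k m₂) ((D n).cast rfl (by omega))
    ((D 1).cast rfl (by omega)) rest rfl (by omega) rfl (by omega) (fun _ => rfl) fun _ => rfl
  have hB := subStep_slide (p := m₁) (q := m₂) (p' := m₁ + k) (q' := k + m₂) (j := k) g (B 1)
    (B n) (.renCons ((D n).cast rfl (by omega)) rest) rfl rfl rfl rfl rfl rfl
    (fun i => by
      simp only [B, bsum_val, idRen_apply, swapRen_val, Ren.cast_val, Fin.cast]
      grind)
    fun i => by
      simp only [B, bsum_val, idRen_apply, swapRen_val, Ren.cast_val, Fin.cast]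
      grind
  have hA := renCons_subStep (x := k + b) (y := k + a) g (swapRen k m₁) (idRen m₂)
    ((A n).cast (by omega) rfl) ((A 1).cast (by omega) rfl)
    (.renCons (B n) (.renCons ((D n).cast rfl (by omega)) rest)) (by omega) rfl (by omega) rfl (fun _ => rfl) fun _ => rfl
  exact ((congrRen _ (congrRen (B 1) hD)).trans (congrRen _ hB)).trans hA

theorem swapRen_natural (k : ℕ) {m n : ℕ} (s : PreSub P.C m n) :
    SubEquiv P (.renCons (swapRen k n) (whiskR k s))
      ((whiskL k s).append (.renCons (swapRen k m) .nil)) := by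
  induction s with
  | nil => rw [whiskL_nil, whiskR_nil, nil_append]; exact refl _
  | subCons m₁ m₂ g rest ih =>
    simp only [subCons_eq_subStep, whiskL_subStep, whiskR_subStep, subStep_append]
    exact (swapRen_subStep k g _ rfl rfl).trans (subStep_congr _ _ g ih)
  | renCons r rest ih =>
    simp only [whiskL_renCons, whiskR_renCons, renCons_append]
    refine .trans ?_ (congrRen _ ih)
    refine (renCons_renCons (swapRen k _) (bsum r (idRen k)) (bsum r (idRen k) ∘ swapRen k _) _
      fun _ => rfl).trans (renCons_renCons (bsum (idRen k) r) (swapRen k _) _ _ fun i => ?_).symm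
    simp only [bsum_val, idRen_apply, swapRen_val, Function.comp]
    grind

theorem swapRen_swapRen (k : ℕ) {m n : ℕ} (s : PreSub P.C m (k + n)) :
    SubEquiv P (.renCons (swapRen k n) (.renCons (swapRen n k) s)) s := by
  refine (renCons_renCons _ _ (idRen _) _ fun i => ?_).trans (unit₂ _)
  simp only [idRen_apply, swapRen_val]
  grind

theorem swapRen_natural' (k : ℕ) {m n : ℕ} (s : PreSub P.C m n) :
    SubEquiv P (.renCons (swapRen n k) (whiskL k s))
      ((whiskR k s).append (.renCons (swapRen m k) .nil)) := by
  have h := append_congr_left (.renCons (swapRen m k) .nil) (swapRen_natural k s)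
  rw [append_assoc, renCons_append, renCons_append, nil_append] at h
  have h' := congrRen (swapRen n k) (h.trans (append_congr_right _ (swapRen_swapRen k nil)))
  rw [append_nil] at h'
  exact h'.symm.trans (swapRen_swapRen n _)

theorem hcast_mk {m n m' n' : ℕ} (h : m = m') (h' : n = n') (s : PreSub P.C m n) :
    hcast (H := SUBQ P) h h' (Quot.mk _ s) = Quot.mk _ (PreSub.cast h h' s) := by
  subst h h'; rfl

end SubEquiv

/-- The pre-PROP structure on `SUB[C]` induced by operations on words. -/
def subPrePROP (P : SymRenPreoperad) : PrePROPOn (SUBQ P) where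
  id n := Quot.mk _ PreSub.nil
  comp f g := Quot.map₂ (fun t s => s.append t) (fun _ _ _ h => SubEquiv.append_congr_left _ h)
    (fun _ _ _ h => SubEquiv.append_congr_right _ h) f g
  comp_id := by rintro a b ⟨s⟩; exact congrArg (Quot.mk _) (PreSub.nil_append s)
  id_comp := by rintro a b ⟨s⟩; exact congrArg (Quot.mk _) (PreSub.append_nil s)
  comp_assoc := by
    rintro a b c d ⟨s⟩ ⟨t⟩ ⟨u⟩
    exact congrArg (Quot.mk _) (PreSub.append_assoc u t s).symm
  whiskL k {_ _} f := Quot.map (PreSub.whiskL k) (fun _ _ => SubEquiv.whiskL_congr k) f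
  whiskR k {_ _} f := Quot.map (PreSub.whiskR k) (fun _ _ => SubEquiv.whiskR_congr k) f
  whiskL_id k n := congrArg (Quot.mk _) (PreSub.whiskL_nil k n)
  whiskR_id k n := congrArg (Quot.mk _) (PreSub.whiskR_nil k n)
  whiskL_comp := by
    rintro k a b c ⟨s⟩ ⟨t⟩; exact congrArg (Quot.mk _) (PreSub.whiskL_append k t s)
  whiskR_comp := by
    rintro k a b c ⟨s⟩ ⟨t⟩; exact congrArg (Quot.mk _) (PreSub.whiskR_append k t s)
  whiskL_zero := by
    rintro m n ⟨s⟩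
    exact (congrArg (Quot.mk _) (PreSub.whiskL_zero s)).trans (SubEquiv.hcast_mk _ _ s).symm
  whiskR_zero := by rintro m n ⟨s⟩; exact congrArg (Quot.mk _) (PreSub.whiskR_zero s)
  whiskL_add := by
    rintro k l m n ⟨s⟩
    exact (congrArg (Quot.mk _) (PreSub.whiskL_add k l s)).trans (SubEquiv.hcast_mk _ _ _).symm
  whiskR_add := by
    rintro k l m n ⟨s⟩
    exact (congrArg (Quot.mk _) (PreSub.whiskR_add k l s)).trans (SubEquiv.hcast_mk _ _ _).symm
  whisk_exch := by
    rintro k l m n ⟨s⟩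
    exact (congrArg (Quot.mk _) (PreSub.whisk_exch k l s)).trans (SubEquiv.hcast_mk _ _ _).symm
  sym m n := Quot.mk _ (PreSub.renCons (swapRen n m) PreSub.nil)
  sym_sym m n := by
    refine Quot.sound ?_
    beta_reduce
    rw [PreSub.renCons_append, PreSub.nil_append]
    exact SubEquiv.swapRen_swapRen _ _
  sym_natL := by
    rintro m n k ⟨s⟩
    refine Quot.sound ?_
    beta_reduce
    rw [PreSub.renCons_append, PreSub.nil_append]
    exact SubEquiv.swapRen_natural k s
  sym_natR := by
    rintro m n k ⟨s⟩
    refine Quot.sound ?_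
    beta_reduce
    rw [PreSub.renCons_append, PreSub.nil_append]
    exact SubEquiv.swapRen_natural' k s
  sym_add m n k := by
    have h : m + n + k = m + (n + k) := by omega
    have h' : m + (k + n) = m + k + n := by omega
    have e : SubEquiv P
        (PreSub.cast rfl (by omega)
          ((PreSub.whiskR n (.renCons (swapRen k m) .nil)).append (PreSub.cast h.symm h'
            (PreSub.whiskL m (.renCons (swapRen k n) .nil)))))
        (PreSub.renCons (swapRen k (m + n)) (PreSub.nil : PreSub P.C (m + n + k) _)) := by
      have hn : PreSub.cast h.symm rfl (PreSub.nil : PreSub P.C (m + (n + k)) _) =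
          PreSub.castU h PreSub.nil := by
        generalize hx : m + (n + k) = x at h
        subst h; rfl
      simp only [PreSub.whiskR_renCons, PreSub.whiskL_renCons, PreSub.whiskR_nil,
        PreSub.whiskL_nil, PreSub.renCons_append, PreSub.nil_append, PreSub.cast_renCons, hn,
        PreSub.renCons_castU, PreSub.cast_nil]
      refine SubEquiv.renCons_renCons _ _ _ _ fun i => ?_
      simp only [bsum_val, idRen_apply, swapRen_val, Ren.cast_val, Fin.cast]
      grind
    refine (Quot.sound e).symm.trans ?_
    rw [← SubEquiv.hcast_mk]
    refine congrArg _ ?_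
    change _ = Quot.map₂ _ _ _ (hcast (H := SUBQ P) _ _
      (Quot.mk _ (PreSub.whiskL m (.renCons (swapRen k n) .nil)))) _
    rw [SubEquiv.hcast_mk]
    rfl

/-- For every symmetric `Ren`-cartesian preoperad `C`, the substitution
construction `SUB[C]` — objects `ℕ`, morphisms the equivalence classes of
pre-substitutions, composition by concatenation, identity the empty word, whiskering by
stepwise padding, and symmetries the singleton renaming words — is a pre-PROP. -/
theorem stmt3 (P : SymRenPreoperad) : ∃ S : PrePROPOn (SUBQ P), InducedC P S :=
  ⟨subPrePROP P, fun _ => rfl, fun _ _ => rfl, fun _ _ _ _ => rfl, fun _ _ _ _ => rfl,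
    fun _ _ => rfl⟩
end
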